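/- Let p : ℝ^n → [1,∞) be measurable with p_+ < ∞ and suppose p(·) satisfies the A_∞ condition. Then there exist γ, C > 1 and ε > 0 such that for every cube Q and every t ∈ [ min(1, ‖χ_Q‖_{p(·)}^{-(1+ε)}), max(1, ‖χ_Q‖_{p(·)}^{-(1+ε)}) ], one has ( (1/|Q|) ∫_Q t^{γ p(x)} dx )^{1/γ} ≤ C (1/|Q|) ∫_Q t^{p(x)} dx. -/

import Mathlib

open MeasureTheory ENNReal Set

noncomputable section

/-- An axis-parallel cube in `ℝⁿ`, given by its center and (positive) side length. -/
structure RCube (n : ℕ) where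
  center : Fin n → ℝ
  side : ℝ
  side_pos : 0 < side

namespace RCube

/-- The (closed) cube as a subset of `ℝⁿ`. -/
def toSet {n : ℕ} (Q : RCube n) : Set (Fin n → ℝ) :=
  {x | ∀ i, |x i - Q.center i| ≤ Q.side / 2}

/-- `rQ`: the cube concentric with `Q` whose side length is `r` times that of `Q`. -/
def scaledSet {n : ℕ} (Q : RCube n) (r : ℝ) : Set (Fin n → ℝ) :=
  {x | ∀ i, |x i - Q.center i| ≤ r * Q.side / 2}

end RCube

/-- A family of pairwise disjoint cubes. -/
def PairwiseDisjointCubes {n : ℕ} (F : Set (RCube n)) : Prop :=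
  F.Pairwise fun Q₁ Q₂ => Disjoint Q₁.toSet Q₂.toSet

/-- The variable Lebesgue norm `‖f‖_{p(·)}` for a real-valued (finite) exponent,
applied to an `ℝ≥0∞`-valued function: `inf {λ > 0 : ∫ (f/λ)^{p(x)} dx ≤ 1}`. -/
def vnorm {n : ℕ} (p : (Fin n → ℝ) → ℝ) (f : (Fin n → ℝ) → ℝ≥0∞) : ℝ≥0∞ :=
  sInf {lam : ℝ≥0∞ | 0 < lam ∧ (∫⁻ x, (f x / lam) ^ p x) ≤ 1}

/-- `t^e` for `t, e ∈ [0,∞]`, with the standard variable-exponent convention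
`t^∞ = 0` for `t ≤ 1` and `t^∞ = ∞` for `t > 1`. -/
def epow (t e : ℝ≥0∞) : ℝ≥0∞ :=
  if e = ∞ then (if t ≤ 1 then 0 else ∞) else t ^ e.toReal

/-- The variable Lebesgue norm for an exponent with values in `[1,∞]`. -/
def vnormE {n : ℕ} (p : (Fin n → ℝ) → ℝ≥0∞) (f : (Fin n → ℝ) → ℝ≥0∞) : ℝ≥0∞ :=
  sInf {lam : ℝ≥0∞ | 0 < lam ∧ (∫⁻ x, epow (f x / lam) (p x)) ≤ 1}

/-- `|f|` as an `ℝ≥0∞`-valued function. -/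
def ofR {n : ℕ} (f : (Fin n → ℝ) → ℝ) : (Fin n → ℝ) → ℝ≥0∞ :=
  fun x => ENNReal.ofReal |f x|

/-- The `ℝ≥0∞`-valued characteristic function of a set. -/
def chiE {n : ℕ} (S : Set (Fin n → ℝ)) : (Fin n → ℝ) → ℝ≥0∞ :=
  S.indicator fun _ => 1

/-- The Hardy--Littlewood maximal operator (over axis-parallel cubes containing `x`). -/
def hlMaximal {n : ℕ} (f : (Fin n → ℝ) → ℝ) (x : Fin n → ℝ) : ℝ≥0∞ :=
  ⨆ (Q : RCube n) (_ : x ∈ Q.toSet),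
    (∫⁻ y in Q.toSet, ENNReal.ofReal |f y|) / volume Q.toSet

/-- `M` is bounded on `L^{p(·)}`: there is `C > 0` with `‖Mf‖_{p(·)} ≤ C ‖f‖_{p(·)}`
for every `f ∈ L^{p(·)}`. -/
def MaximalBounded {n : ℕ} (p : (Fin n → ℝ) → ℝ) : Prop :=
  ∃ C > (0 : ℝ), ∀ f : (Fin n → ℝ) → ℝ, Measurable f → vnorm p (ofR f) < ∞ →
    vnorm p (hlMaximal f) ≤ ENNReal.ofReal C * vnorm p (ofR f)

/-- The function `∑_{Q ∈ F} t_Q χ_{E_Q}` (for a pairwise disjoint family,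
written as a pointwise supremum). -/
def cubeSum {n : ℕ} (F : Set (RCube n)) (t : RCube n → ℝ)
    (E : RCube n → Set (Fin n → ℝ)) (x : Fin n → ℝ) : ℝ≥0∞ :=
  ⨆ (Q : RCube n) (_ : Q ∈ F) (_ : x ∈ E Q), ENNReal.ofReal (t Q)

/-- `p(·)` satisfies the `A_∞` condition with parameter `lam` and constant `C`. -/
def AInftyWith {n : ℕ} (p : (Fin n → ℝ) → ℝ) (lam C : ℝ) : Prop :=
  ∀ F : Set (RCube n), PairwiseDisjointCubes F →
    ∀ t : RCube n → ℝ, (∀ Q ∈ F, 0 ≤ t Q) →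
      ∀ E : RCube n → Set (Fin n → ℝ),
        (∀ Q ∈ F, MeasurableSet (E Q) ∧ E Q ⊆ Q.toSet ∧
          ENNReal.ofReal lam * volume Q.toSet ≤ volume (E Q)) →
        vnorm p (cubeSum F t RCube.toSet) ≤ ENNReal.ofReal C * vnorm p (cubeSum F t E)

/-- The `A_∞` condition for a real-valued exponent. -/
def AInfty {n : ℕ} (p : (Fin n → ℝ) → ℝ) : Prop :=
  ∃ lam ∈ Ioo (0 : ℝ) 1, ∃ C > (0 : ℝ), AInftyWith p lam C

/-- `p(·)` satisfies the `A_∞` condition with parameter `lam` and constant `C`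
(exponent with values in `[1,∞]`). -/
def AInftyWithE {n : ℕ} (p : (Fin n → ℝ) → ℝ≥0∞) (lam C : ℝ) : Prop :=
  ∀ F : Set (RCube n), PairwiseDisjointCubes F →
    ∀ t : RCube n → ℝ, (∀ Q ∈ F, 0 ≤ t Q) →
      ∀ E : RCube n → Set (Fin n → ℝ),
        (∀ Q ∈ F, MeasurableSet (E Q) ∧ E Q ⊆ Q.toSet ∧
          ENNReal.ofReal lam * volume Q.toSet ≤ volume (E Q)) →
        vnormE p (cubeSum F t RCube.toSet) ≤ ENNReal.ofReal C * vnormE p (cubeSum F t E)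

/-- The `A_∞` condition for an exponent with values in `[1,∞]`. -/
def AInftyE {n : ℕ} (p : (Fin n → ℝ) → ℝ≥0∞) : Prop :=
  ∃ lam ∈ Ioo (0 : ℝ) 1, ∃ C > (0 : ℝ), AInftyWithE p lam C

/-- The nonincreasing-rearrangement value `(f χ_Q)^*(s) = inf {α : |{x ∈ Q : |f x| > α}| ≤ s}`. -/
def rearr {n : ℕ} (f : (Fin n → ℝ) → ℝ) (Q : RCube n) (s : ℝ≥0∞) : ℝ≥0∞ :=
  sInf {a : ℝ≥0∞ | volume {x | x ∈ Q.toSet ∧ a < ENNReal.ofReal |f x|} ≤ s}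

/-- The `λ`-median maximal operator `m_λ`. -/
def medianMax {n : ℕ} (lam : ℝ) (f : (Fin n → ℝ) → ℝ) (x : Fin n → ℝ) : ℝ≥0∞ :=
  ⨆ (Q : RCube n) (_ : x ∈ Q.toSet), rearr f Q (ENNReal.ofReal lam * volume Q.toSet)

/-- The modified median maximal operator `m_{τ,r}` (supremum over cubes `Q` with `x ∈ rQ`). -/
def medianMaxR {n : ℕ} (tau r : ℝ) (f : (Fin n → ℝ) → ℝ) (x : Fin n → ℝ) : ℝ≥0∞ :=
  ⨆ (Q : RCube n) (_ : x ∈ Q.scaledSet r), rearr f Q (ENNReal.ofReal tau * volume Q.toSet)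

/-- The average `⟨f⟩_Q = (1/|Q|) ∫_Q f`. -/
def cubeAvg {n : ℕ} (f : (Fin n → ℝ) → ℝ) (Q : RCube n) : ℝ :=
  (∫ y in Q.toSet, f y) / (volume Q.toSet).toReal

/-- `|T_F f|` for a pairwise disjoint family `F`, written as a pointwise supremum. -/
def avgSum {n : ℕ} (F : Set (RCube n)) (f : (Fin n → ℝ) → ℝ) (x : Fin n → ℝ) : ℝ≥0∞ :=
  ⨆ (Q : RCube n) (_ : Q ∈ F) (_ : x ∈ Q.toSet), ENNReal.ofReal |cubeAvg f Q|

/-- The reverse Hölder condition `RH`. -/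
def RHCond {n : ℕ} (p : (Fin n → ℝ) → ℝ) : Prop :=
  ∃ r : ℝ, 1 < r ∧ ∃ C : ℝ, 0 < C ∧
    ∀ S : Set (RCube n), PairwiseDisjointCubes S →
      ∀ t : RCube n → ℝ, (∀ Q ∈ S, 0 ≤ t Q) →
        (∑' Q : S, ∫⁻ x in Q.1.toSet, ENNReal.ofReal (t Q.1) ^ p x) ≤ 1 →
        (∑' Q : S, volume Q.1.toSet *
            ((∫⁻ x in Q.1.toSet, ENNReal.ofReal (t Q.1) ^ (r * p x)) / volume Q.1.toSet)
              ^ (1 / r)) ≤ ENNReal.ofReal C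

/-! ### Dyadic cells -/

/-- Dyadic index of a point at level `m`, relative to the cube `Q`. -/
def didx {n : ℕ} (Q : RCube n) (m : ℕ) (x : Fin n → ℝ) : Fin n → ℤ :=
  fun i => ⌊(2 : ℝ) ^ m * ((x i - Q.center i) / Q.side + 1 / 2)⌋

/-- Dyadic half-open cell. -/
def dcell {n : ℕ} (Q : RCube n) (m : ℕ) (k : Fin n → ℤ) : Set (Fin n → ℝ) :=
  {x | didx Q m x = k}

/-- Closed cube concentric with a dyadic cell, dilated by `r`. -/
def dcube {n : ℕ} (Q : RCube n) (r : ℝ) (hr : 0 < r) (m : ℕ) (k : Fin n → ℤ) : RCube n where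
  center := fun i => Q.center i + Q.side * ((k i + 1 / 2) / 2 ^ m - 1 / 2)
  side := r * (Q.side / 2 ^ m)
  side_pos := by have := Q.side_pos; positivity

lemma didx_mono {n : ℕ} (Q : RCube n) {m m' : ℕ} (h : m' ≤ m) {x y : Fin n → ℝ}
    (hxy : didx Q m x = didx Q m y) : didx Q m' x = didx Q m' y := by
  have key : ∀ z : Fin n → ℝ, ∀ i, didx Q m' z i = didx Q m z i / ((2 ^ (m - m') : ℕ) : ℤ) := by
    intro z i
    unfold didx
    rw [← Int.floor_div_natCast]
    congr 1
    have : (2 : ℝ) ^ m = 2 ^ m' * 2 ^ (m - m') := by rw [← pow_add]; congr 1; omega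
    rw [this]
    push_cast
    field_simp
  funext i
  rw [key, key, hxy]

lemma toSet_eq_Icc {n : ℕ} (Q : RCube n) :
    Q.toSet = Icc (fun i => Q.center i - Q.side / 2) (fun i => Q.center i + Q.side / 2) := by
  ext x
  simp only [RCube.toSet, mem_ofPred_eq, mem_Icc, Pi.le_def, abs_le]
  constructor
  · intro h
    exact ⟨fun i => by linarith [(h i).1], fun i => by linarith [(h i).2]⟩
  · rintro ⟨h1, h2⟩ i
    exact ⟨by linarith [h1 i], by linarith [h2 i]⟩

lemma toSet_eq_closedBall {n : ℕ} (Q : RCube n) :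
    Q.toSet = Metric.closedBall Q.center (Q.side / 2) := by
  ext x
  have := Q.side_pos
  rw [Metric.mem_closedBall, dist_pi_le_iff (by positivity)]
  simp [RCube.toSet, Real.dist_eq]

lemma measurableSet_toSet {n : ℕ} (Q : RCube n) : MeasurableSet Q.toSet := by
  rw [toSet_eq_Icc]; exact measurableSet_Icc

lemma volume_toSet {n : ℕ} (Q : RCube n) : volume Q.toSet = ENNReal.ofReal Q.side ^ n := by
  rw [toSet_eq_Icc, Real.volume_Icc_pi]
  have : ∀ i, Q.center i + Q.side / 2 - (Q.center i - Q.side / 2) = Q.side := by intro i; ring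
  simp [this]

lemma volume_toSet_pos {n : ℕ} (Q : RCube n) : 0 < volume Q.toSet := by
  rw [volume_toSet]
  exact ENNReal.pow_pos (ENNReal.ofReal_pos.2 Q.side_pos) n

lemma volume_toSet_ne_top {n : ℕ} (Q : RCube n) : volume Q.toSet ≠ ∞ := by
  rw [volume_toSet]
  exact ENNReal.pow_ne_top ENNReal.ofReal_ne_top

lemma mem_dcell_iff {n : ℕ} (Q : RCube n) (m : ℕ) (k : Fin n → ℤ) (x : Fin n → ℝ) :
    x ∈ dcell Q m k ↔ ∀ i, -(Q.side / 2 ^ m / 2) ≤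
        x i - (dcube Q 1 one_pos m k).center i ∧
      x i - (dcube Q 1 one_pos m k).center i < Q.side / 2 ^ m / 2 := by
  have hs := Q.side_pos
  have h2 : (0 : ℝ) < 2 ^ m := by positivity
  simp only [dcell, mem_ofPred_eq, funext_iff, didx, Int.floor_eq_iff, dcube]
  refine forall_congr' fun i => ?_
  have e : x i - (Q.center i + Q.side * ((k i + 1 / 2) / 2 ^ m - 1 / 2)) =
      (Q.side / 2 ^ m) * (2 ^ m * ((x i - Q.center i) / Q.side + 1 / 2) - k i - 1 / 2) := by
    field_simp
    ring
  rw [e]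
  set z := (2 : ℝ) ^ m * ((x i - Q.center i) / Q.side + 1 / 2)
  have hd : 0 < Q.side / 2 ^ m := by positivity
  set d := Q.side / 2 ^ m
  constructor
  · rintro ⟨h1, h2⟩
    constructor <;> nlinarith
  · rintro ⟨h1, h2⟩
    constructor
    · by_contra hc
      push Not at hc
      nlinarith
    · by_contra hc
      push Not at hc
      nlinarith

lemma dcell_eq_pi {n : ℕ} (Q : RCube n) (m : ℕ) (k : Fin n → ℤ) :
    dcell Q m k = Set.pi univ fun i =>
      Ico ((dcube Q 1 one_pos m k).center i - (dcube Q 1 one_pos m k).side / 2)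
        ((dcube Q 1 one_pos m k).center i + (dcube Q 1 one_pos m k).side / 2) := by
  ext x
  rw [mem_dcell_iff]
  have : (dcube Q 1 one_pos m k).side = Q.side / 2 ^ m := by simp [dcube]
  simp only [Set.mem_pi, mem_univ, forall_true_left, mem_Ico, this]
  refine forall_congr' fun i => ?_
  constructor <;> rintro ⟨h1, h2⟩ <;> constructor <;> linarith

lemma dcell_ae_eq {n : ℕ} (Q : RCube n) (m : ℕ) (k : Fin n → ℤ) :
    dcell Q m k =ᵐ[volume] (dcube Q 1 one_pos m k).toSet := by
  rw [dcell_eq_pi, toSet_eq_Icc]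
  exact Measure.univ_pi_Ico_ae_eq_Icc

lemma measurableSet_dcell {n : ℕ} (Q : RCube n) (m : ℕ) (k : Fin n → ℤ) :
    MeasurableSet (dcell Q m k) := by
  rw [dcell_eq_pi]
  exact MeasurableSet.univ_pi fun i => measurableSet_Ico

lemma volume_dcell {n : ℕ} (Q : RCube n) (m : ℕ) (k : Fin n → ℤ) :
    volume (dcell Q m k) = ENNReal.ofReal (Q.side / 2 ^ m) ^ n := by
  rw [measure_congr (dcell_ae_eq Q m k), volume_toSet]
  simp [dcube]

lemma volume_dcell_pos {n : ℕ} (Q : RCube n) (m : ℕ) (k : Fin n → ℤ) :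
    0 < volume (dcell Q m k) := by
  rw [measure_congr (dcell_ae_eq Q m k)]
  exact volume_toSet_pos _

lemma volume_dcell_ne_top {n : ℕ} (Q : RCube n) (m : ℕ) (k : Fin n → ℤ) :
    volume (dcell Q m k) ≠ ∞ := by
  rw [measure_congr (dcell_ae_eq Q m k)]
  exact volume_toSet_ne_top _

lemma volume_dcell_succ {n : ℕ} (Q : RCube n) (m : ℕ) (k k' : Fin n → ℤ) :
    volume (dcell Q m k) = 2 ^ n * volume (dcell Q (m + 1) k') := by
  rw [volume_dcell, volume_dcell, ← mul_pow]
  congr 1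
  rw [show (2 : ℝ≥0∞) = ENNReal.ofReal 2 by simp, ← ENNReal.ofReal_mul (by norm_num)]
  congr 1
  rw [pow_succ]
  field_simp

lemma dcube_zero {n : ℕ} (Q : RCube n) :
    (dcube Q 1 one_pos 0 0) = Q := by
  cases Q
  simp [dcube]

lemma dcube_subset_dcell {n : ℕ} (Q : RCube n) {r : ℝ} (hr : 0 < r) (hr1 : r < 1) (m : ℕ)
    (k : Fin n → ℤ) : (dcube Q r hr m k).toSet ⊆ dcell Q m k := by
  intro x hx
  rw [mem_dcell_iff]
  intro i
  have h := hx i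
  have hd : 0 < Q.side / 2 ^ m := by have := Q.side_pos; positivity
  have e : (dcube Q r hr m k).center i = (dcube Q 1 one_pos m k).center i := rfl
  have e2 : (dcube Q r hr m k).side = r * (Q.side / 2 ^ m) := rfl
  rw [e, e2, abs_le] at h
  constructor <;> nlinarith [h.1, h.2]

lemma volume_dcube {n : ℕ} (Q : RCube n) {r : ℝ} (hr : 0 < r) (m : ℕ)
    (k : Fin n → ℤ) :
    volume (dcube Q r hr m k).toSet = ENNReal.ofReal r ^ n * volume (dcell Q m k) := by
  rw [volume_toSet, volume_dcell, ← mul_pow, ← ENNReal.ofReal_mul hr.le]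
  rfl

lemma dcube_mono {n : ℕ} (Q : RCube n) {r r' : ℝ} (hr : 0 < r) (hr' : 0 < r') (h : r ≤ r') (m : ℕ)
    (k : Fin n → ℤ) : (dcube Q r hr m k).toSet ⊆ (dcube Q r' hr' m k).toSet := by
  intro x hx i
  have h1 := hx i
  have hd : 0 < Q.side / 2 ^ m := by have := Q.side_pos; positivity
  refine h1.trans ?_
  simp only [dcube]
  gcongr

/-- The sequence of dilation parameters increasing to one. -/
def rseq (j : ℕ) : ℝ := 1 - 1 / (j + 2)

lemma rseq_half (j : ℕ) : 1 / 2 ≤ rseq j := by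
  unfold rseq
  have : (1 : ℝ) / (j + 2) ≤ 1 / 2 := by
    apply one_div_le_one_div_of_le (by norm_num)
    have : (0 : ℝ) ≤ j := by positivity
    linarith
  linarith

lemma rseq_pos (j : ℕ) : 0 < rseq j := lt_of_lt_of_le (by norm_num) (rseq_half j)

lemma rseq_lt (j : ℕ) : rseq j < 1 := by
  unfold rseq
  have : (0 : ℝ) < 1 / (j + 2) := by positivity
  linarith

lemma rseq_mono : Monotone rseq := by
  intro i j h
  unfold rseq
  have : (1 : ℝ) / (j + 2) ≤ 1 / (i + 2) := by
    apply one_div_le_one_div_of_le (by positivity)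
    have : (i : ℝ) ≤ j := by exact_mod_cast h
    linarith
  linarith

lemma rseq_tendsto : Filter.Tendsto rseq Filter.atTop (nhds 1) := by
  unfold rseq
  have h : Filter.Tendsto (fun j : ℕ => (1 : ℝ) / ((j : ℝ) + 2)) Filter.atTop (nhds 0) := by
    have := (tendsto_one_div_add_atTop_nhds_zero_nat (𝕜 := ℝ)).comp (Filter.tendsto_add_atTop_nat 1)
    refine this.congr fun j => ?_
    simp only [Function.comp]
    push_cast
    congr 1
    ring
  simpa using h.const_sub 1

lemma dcell_ae_le_iUnion {n : ℕ} (Q : RCube n) (m : ℕ) (k : Fin n → ℤ) :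
    ∀ᵐ x ∂(volume : Measure (Fin n → ℝ)), x ∈ dcell Q m k →
      ∃ j, x ∈ (dcube Q (rseq j) (rseq_pos j) m k).toSet := by
  have h1 : (Set.pi univ fun i =>
      Ioo ((dcube Q 1 one_pos m k).center i - (dcube Q 1 one_pos m k).side / 2)
        ((dcube Q 1 one_pos m k).center i + (dcube Q 1 one_pos m k).side / 2)) =ᵐ[volume]
      dcell Q m k := by
    refine Filter.EventuallyEq.trans ?_ (dcell_ae_eq Q m k).symm
    rw [toSet_eq_Icc]
    exact Measure.univ_pi_Ioo_ae_eq_Icc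
  filter_upwards [h1.mem_iff] with x hx hxc
  have hx' := hx.2 hxc
  simp only [Set.mem_pi, mem_univ, forall_true_left, mem_Ioo] at hx'
  have hd : 0 < Q.side / 2 ^ m := by have := Q.side_pos; positivity
  have e2 : (dcube Q 1 one_pos m k).side = Q.side / 2 ^ m := by simp [dcube]
  rw [e2] at hx'
  have hev : ∀ i, ∀ᶠ j in Filter.atTop,
      |x i - (dcube Q 1 one_pos m k).center i| ≤ rseq j * (Q.side / 2 ^ m) / 2 := by
    intro i
    have hlt : |x i - (dcube Q 1 one_pos m k).center i| < 1 * (Q.side / 2 ^ m) / 2 := by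
      rw [abs_lt]
      constructor <;> linarith [(hx' i).1, (hx' i).2]
    have ht : Filter.Tendsto (fun j => rseq j * (Q.side / 2 ^ m) / 2) Filter.atTop
        (nhds (1 * (Q.side / 2 ^ m) / 2)) := (rseq_tendsto.mul_const _).div_const _
    exact (ht.eventually (lt_mem_nhds hlt)).mono fun j hj => hj.le
  obtain ⟨j, hj⟩ := (Filter.eventually_all.2 hev).exists
  exact ⟨j, hj⟩


/-! ### Stopping cells -/

/-- The cell `(m, k)` has average of `w` above `θ`. -/
def dbad {n : ℕ} (Q : RCube n) (w : (Fin n → ℝ) → ℝ≥0∞) (θ : ℝ≥0∞) (m : ℕ) (k : Fin n → ℤ) : Prop :=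
  θ * volume (dcell Q m k) < ∫⁻ x in dcell Q m k, w x

/-- Level set of the dyadic maximal function. -/
def dOm {n : ℕ} (Q : RCube n) (w : (Fin n → ℝ) → ℝ≥0∞) (θ : ℝ≥0∞) : Set (Fin n → ℝ) :=
  {x | ∃ m, dbad Q w θ m (didx Q m x)}

/-- Maximal bad cells. -/
def dSel {n : ℕ} (Q : RCube n) (w : (Fin n → ℝ) → ℝ≥0∞) (θ : ℝ≥0∞) : Set (ℕ × (Fin n → ℤ)) :=
  {q | dbad Q w θ q.1 q.2 ∧ ∀ x ∈ dcell Q q.1 q.2, ∀ m' < q.1, ¬ dbad Q w θ m' (didx Q m' x)}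

lemma dbad_mono {n : ℕ} {Q : RCube n} {w : (Fin n → ℝ) → ℝ≥0∞} {θ θ' : ℝ≥0∞} (h : θ ≤ θ') {m : ℕ}
    {k : Fin n → ℤ} (hb : dbad Q w θ' m k) : dbad Q w θ m k :=
  lt_of_le_of_lt (by gcongr) hb

lemma dOm_anti {n : ℕ} {Q : RCube n} {w : (Fin n → ℝ) → ℝ≥0∞} {θ θ' : ℝ≥0∞} (h : θ ≤ θ') :
    dOm Q w θ' ⊆ dOm Q w θ := fun _ ⟨m, hm⟩ => ⟨m, dbad_mono h hm⟩

lemma dSel_subset {n : ℕ} {Q : RCube n} {w : (Fin n → ℝ) → ℝ≥0∞} {θ : ℝ≥0∞}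
    {q : ℕ × (Fin n → ℤ)} (hq : q ∈ dSel Q w θ) : dcell Q q.1 q.2 ⊆ dOm Q w θ := by
  intro x hx
  refine ⟨q.1, ?_⟩
  have : didx Q q.1 x = q.2 := hx
  rw [this]
  exact hq.1

lemma exists_dSel {n : ℕ} {Q : RCube n} {w : (Fin n → ℝ) → ℝ≥0∞} {θ : ℝ≥0∞}
    {x : Fin n → ℝ} (hx : x ∈ dOm Q w θ) : ∃ q ∈ dSel Q w θ, x ∈ dcell Q q.1 q.2 := by
  classical
  have hx' : ∃ m, dbad Q w θ m (didx Q m x) := hx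
  refine ⟨(Nat.find hx', didx Q (Nat.find hx') x), ⟨Nat.find_spec hx', ?_⟩, rfl⟩
  intro y hy m' hm'
  have hy' : didx Q (Nat.find hx') y = didx Q (Nat.find hx') x := hy
  rw [didx_mono Q hm'.le hy']
  exact Nat.find_min hx' hm'

lemma dOm_eq {n : ℕ} (Q : RCube n) (w : (Fin n → ℝ) → ℝ≥0∞) (θ : ℝ≥0∞) :
    dOm Q w θ = ⋃ q ∈ dSel Q w θ, dcell Q q.1 q.2 := by
  ext x
  simp only [mem_iUnion, exists_prop]
  exact ⟨exists_dSel, fun ⟨q, hq, hx⟩ => dSel_subset hq hx⟩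

lemma measurableSet_dOm {n : ℕ} (Q : RCube n) (w : (Fin n → ℝ) → ℝ≥0∞) (θ : ℝ≥0∞) :
    MeasurableSet (dOm Q w θ) := by
  rw [dOm_eq]
  exact MeasurableSet.biUnion (to_countable _) fun q _ => measurableSet_dcell Q _ _

lemma dSel_unique {n : ℕ} {Q : RCube n} {w : (Fin n → ℝ) → ℝ≥0∞} {θ : ℝ≥0∞}
    {q q' : ℕ × (Fin n → ℤ)} (hq : q ∈ dSel Q w θ) (hq' : q' ∈ dSel Q w θ) {x : Fin n → ℝ}
    (hx : x ∈ dcell Q q.1 q.2) (hx' : x ∈ dcell Q q'.1 q'.2) : q = q' := by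
  have e1 : didx Q q.1 x = q.2 := hx
  have e2 : didx Q q'.1 x = q'.2 := hx'
  have h1 : ¬ q.1 < q'.1 := fun h => hq'.2 x hx' _ h (by rw [e1]; exact hq.1)
  have h2 : ¬ q'.1 < q.1 := fun h => hq.2 x hx _ h (by rw [e2]; exact hq'.1)
  have h3 : q.1 = q'.1 := by omega
  refine Prod.ext h3 ?_
  rw [← e1, ← e2, h3]

lemma dOm_inter_le {n : ℕ} {Q : RCube n} {w : (Fin n → ℝ) → ℝ≥0∞} {θ θ' : ℝ≥0∞} (h : θ ≤ θ')
    (h0 : ∀ k, ¬ dbad Q w θ 0 k) {q : ℕ × (Fin n → ℤ)} (hq : q ∈ dSel Q w θ) :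
    θ' * volume (dOm Q w θ' ∩ dcell Q q.1 q.2) ≤ 2 ^ n * θ * volume (dcell Q q.1 q.2) := by
  set D := dcell Q q.1 q.2 with hD
  let S : Set (ℕ × (Fin n → ℤ)) := {q' | q' ∈ dSel Q w θ' ∧ dcell Q q'.1 q'.2 ⊆ D}
  have hsub : dOm Q w θ' ∩ D ⊆ ⋃ q' ∈ S, dcell Q q'.1 q'.2 := by
    rintro x ⟨hx, hxD⟩
    obtain ⟨q', hq', hxq'⟩ := exists_dSel hx
    have e1 : didx Q q'.1 x = q'.2 := hxq'
    have e2 : didx Q q.1 x = q.2 := hxD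
    have hle : q.1 ≤ q'.1 := by
      by_contra hc
      push Not at hc
      refine hq.2 x hxD _ hc ?_
      rw [e1]
      exact dbad_mono h hq'.1
    simp only [mem_iUnion, exists_prop]
    refine ⟨q', ⟨hq', ?_⟩, hxq'⟩
    intro y hy
    have e3 : didx Q q'.1 y = q'.2 := hy
    change didx Q q.1 y = q.2
    rw [← e2]
    exact didx_mono Q hle (e3.trans e1.symm)
  have hdisj : S.PairwiseDisjoint (fun q' => dcell Q q'.1 q'.2) := by
    intro a ha b hb hab
    refine Set.disjoint_left.2 fun x hxa hxb => hab (dSel_unique ha.1 hb.1 hxa hxb)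
  have hDpos : ∫⁻ x in D, w x ≤ 2 ^ n * θ * volume D := by
    rcases Nat.eq_zero_or_eq_succ_pred q.1 with h1 | h1
    · exfalso
      have := hq.1
      rw [h1] at this
      exact h0 _ this
    · have hne : D.Nonempty := nonempty_of_measure_ne_zero (volume_dcell_pos Q _ _).ne'
      obtain ⟨x, hx⟩ := hne
      have hnb := hq.2 x hx (q.1.pred) (by omega)
      unfold dbad at hnb
      push Not at hnb
      have hsub2 : D ⊆ dcell Q q.1.pred (didx Q q.1.pred x) := by
        intro y hy
        have e1 : didx Q q.1 x = q.2 := hx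
        have e2 : didx Q q.1 y = q.2 := hy
        exact didx_mono Q (by omega) (e2.trans e1.symm)
      refine (lintegral_mono_set hsub2).trans (hnb.trans (le_of_eq ?_))
      rw [volume_dcell_succ Q q.1.pred _ q.2, hD]
      have : q.1.pred + 1 = q.1 := by omega
      rw [this]
      ring
  calc θ' * volume (dOm Q w θ' ∩ D) ≤ θ' * volume (⋃ q' ∈ S, dcell Q q'.1 q'.2) := by gcongr
    _ = θ' * ∑' q' : S, volume (dcell Q q'.1.1 q'.1.2) := by
        rw [measure_biUnion (to_countable _) hdisj fun q' _ => measurableSet_dcell Q _ _]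
    _ = ∑' q' : S, θ' * volume (dcell Q q'.1.1 q'.1.2) := by rw [ENNReal.tsum_mul_left]
    _ ≤ ∑' q' : S, ∫⁻ x in dcell Q q'.1.1 q'.1.2, w x :=
        ENNReal.tsum_le_tsum fun q' => (q'.2.1.1).le
    _ = ∫⁻ x in ⋃ q' ∈ S, dcell Q q'.1 q'.2, w x := by
        rw [lintegral_biUnion (to_countable _) (fun q' _ => measurableSet_dcell Q _ _) hdisj]
    _ ≤ ∫⁻ x in D, w x := lintegral_mono_set (iUnion₂_subset fun q' hq' => hq'.2)
    _ ≤ _ := hDpos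

lemma ae_mem_dOm {n : ℕ} (Q : RCube n) {w : (Fin n → ℝ) → ℝ≥0∞} (hw : Measurable w)
    (hfin : ∫⁻ x, w x ≠ ∞) :
    ∀ᵐ x ∂(volume : Measure (Fin n → ℝ)), ∀ θ, θ < w x → x ∈ dOm Q w θ := by
  have := (IsUnifLocDoublingMeasure.vitaliFamily (volume : Measure (Fin n → ℝ)) 1
    ).ae_tendsto_lintegral_div hw.aemeasurable hfin
  filter_upwards [this] with x hx θ hθ
  have hs := Q.side_pos
  have hlim : Filter.Tendsto (fun m : ℕ => (dcube Q 1 one_pos m (didx Q m x)).side / 2)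
      Filter.atTop (nhdsWithin 0 (Ioi 0)) := by
    rw [tendsto_nhdsWithin_iff]
    constructor
    · have h1 : Filter.Tendsto (fun m : ℕ => Q.side / 2 * ((1 : ℝ) / 2) ^ m) Filter.atTop
          (nhds (Q.side / 2 * 0)) :=
        (_root_.tendsto_pow_atTop_nhds_zero_of_lt_one (by norm_num) (by norm_num)).const_mul _
      rw [mul_zero] at h1
      refine h1.congr fun m => ?_
      simp only [dcube, one_mul, one_div, inv_pow]
      field_simp
    · filter_upwards with m
      have := (dcube Q 1 one_pos m (didx Q m x)).side_pos
      simp only [mem_Ioi]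
      positivity
  have hmem : ∀ m, x ∈ (dcube Q 1 one_pos m (didx Q m x)).toSet := by
    intro m i
    have h1 := (mem_dcell_iff Q m (didx Q m x) x).1 rfl i
    rw [abs_le]
    have e2 : (dcube Q 1 one_pos m (didx Q m x)).side = Q.side / 2 ^ m := by simp [dcube]
    rw [e2]
    exact ⟨h1.1, h1.2.le⟩
  have ht := IsUnifLocDoublingMeasure.tendsto_closedBall_filterAt (K := 1) (x := x)
    (volume : Measure (Fin n → ℝ))
    (fun m : ℕ => (dcube Q 1 one_pos m (didx Q m x)).center) _ hlim
    (by
      filter_upwards with m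
      rw [one_mul, ← toSet_eq_closedBall]
      exact hmem m)
  obtain ⟨m, hm⟩ := ((hx.comp ht).eventually (lt_mem_nhds hθ)).exists
  refine ⟨m, ?_⟩
  simp only [Function.comp, ← toSet_eq_closedBall] at hm
  rw [← measure_congr (dcell_ae_eq Q m _), ← setLIntegral_congr (dcell_ae_eq Q m _)] at hm
  unfold dbad
  rw [ENNReal.lt_div_iff_mul_lt (Or.inl (volume_dcell_pos Q _ _).ne')
    (Or.inl (volume_dcell_ne_top Q _ _))] at hm
  exact hm


/-! ### Norms of characteristic functions -/

lemma lintegral_chiE {n : ℕ} {p : (Fin n → ℝ) → ℝ} (hp1 : ∀ x, 1 ≤ p x)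
    {A : Set (Fin n → ℝ)} (hA : MeasurableSet A) (L : ℝ≥0∞) :
    (∫⁻ x, (chiE A x / L) ^ p x) = ∫⁻ x in A, L⁻¹ ^ p x := by
  rw [← lintegral_indicator hA]
  refine lintegral_congr fun x => ?_
  by_cases hx : x ∈ A
  · simp [chiE, hx]
  · have : 0 < p x := lt_of_lt_of_le one_pos (hp1 x)
    simp [chiE, hx, this]

lemma vn_le {n : ℕ} {p : (Fin n → ℝ) → ℝ} (hp1 : ∀ x, 1 ≤ p x)
    {A : Set (Fin n → ℝ)} (hA : MeasurableSet A) {L : ℝ≥0∞} (hL : 0 < L)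
    (h : ∫⁻ x in A, L⁻¹ ^ p x ≤ 1) : vnorm p (chiE A) ≤ L := by
  refine sInf_le ⟨hL, ?_⟩
  rw [lintegral_chiE hp1 hA]
  exact h

lemma vn_lt {n : ℕ} {p : (Fin n → ℝ) → ℝ} (hp1 : ∀ x, 1 ≤ p x)
    {A : Set (Fin n → ℝ)} (hA : MeasurableSet A) {L : ℝ≥0∞}
    (h : vnorm p (chiE A) < L) : ∫⁻ x in A, L⁻¹ ^ p x ≤ 1 := by
  obtain ⟨L', ⟨_, hL'⟩, hlt⟩ := sInf_lt_iff.1 h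
  rw [lintegral_chiE hp1 hA] at hL'
  refine le_trans (lintegral_mono fun x => ?_) hL'
  have : 0 ≤ p x := zero_le_one.trans (hp1 x)
  exact ENNReal.rpow_le_rpow (ENNReal.inv_le_inv.2 hlt.le) this

lemma vn_mono {n : ℕ} {p : (Fin n → ℝ) → ℝ} (hp1 : ∀ x, 1 ≤ p x)
    {A B : Set (Fin n → ℝ)} (h : A ⊆ B) :
    vnorm p (chiE A) ≤ vnorm p (chiE B) := by
  refine sInf_le_sInf fun L hL => ⟨hL.1, le_trans (lintegral_mono fun x => ?_) hL.2⟩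
  have : 0 ≤ p x := zero_le_one.trans (hp1 x)
  refine ENNReal.rpow_le_rpow (ENNReal.div_le_div_right ?_ _) this
  exact indicator_le_indicator_of_subset h (fun _ => zero_le) x

lemma vn_lim {n : ℕ} {p : (Fin n → ℝ) → ℝ} (hp1 : ∀ x, 1 ≤ p x)
    {A : Set (Fin n → ℝ)} (hA : MeasurableSet A) {S : ℕ → Set (Fin n → ℝ)}
    (hS : ∀ j, MeasurableSet (S j)) (hmono : Monotone S)
    (hsub : ∀ᵐ x ∂(volume : Measure (Fin n → ℝ)), x ∈ A → x ∈ ⋃ j, S j) {V : ℝ≥0∞}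
    (hV : ∀ j, vnorm p (chiE (S j)) ≤ V) : vnorm p (chiE A) ≤ V := by
  refine le_of_forall_gt fun L hL => ?_
  obtain ⟨L', h1, h2⟩ := exists_between hL
  refine lt_of_le_of_lt (vn_le hp1 hA (pos_of_gt h1) ?_) h2
  calc ∫⁻ x in A, L'⁻¹ ^ p x ≤ ∫⁻ x in ⋃ j, S j, L'⁻¹ ^ p x :=
        lintegral_mono_set' hsub
    _ = ⨆ j, ∫⁻ x in S j, L'⁻¹ ^ p x := by
        rw [setLIntegral_iUnion_of_directed _ hmono.directed_le]
    _ ≤ 1 := iSup_le fun j => vn_lt hp1 (hS j) ((hV j).trans_lt h1)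

lemma cubeSum_one {n : ℕ} (F : Set (RCube n)) (E : RCube n → Set (Fin n → ℝ)) :
    cubeSum F (fun _ => 1) E = chiE (⋃ Q ∈ F, E Q) := by
  funext x
  unfold cubeSum chiE
  by_cases hx : x ∈ ⋃ Q ∈ F, E Q
  · rw [indicator_of_mem hx]
    simp only [mem_iUnion, exists_prop] at hx
    obtain ⟨Q, hQ, hxQ⟩ := hx
    refine le_antisymm (iSup_le fun _ => iSup_le fun _ => iSup_le fun _ => by simp) ?_
    refine le_iSup_of_le Q (le_iSup_of_le hQ (le_iSup_of_le hxQ (by simp)))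
  · rw [indicator_of_notMem hx]
    simp only [mem_iUnion, exists_prop, not_exists, not_and] at hx
    refine le_antisymm (iSup_le fun Q => iSup_le fun hQ => iSup_le fun h => ?_) (zero_le)
    exact absurd h (hx Q hQ)

lemma ainf_step {n : ℕ} {p : (Fin n → ℝ) → ℝ} (hp1 : ∀ x, 1 ≤ p x) {lam C : ℝ}
    (hl0 : 0 < lam) (hl1 : lam < 1) (hA : AInftyWith p lam C) (Q : RCube n)
    (w : (Fin n → ℝ) → ℝ≥0∞) {θ θ' : ℝ≥0∞} (h : θ ≤ θ') (h0 : ∀ k, ¬ dbad Q w θ 0 k)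
    (hθ0 : θ' ≠ 0) (hθt : θ' ≠ ∞)
    (hθ : 4 ^ n * θ ≤ ENNReal.ofReal (1 - lam) * θ') :
    vnorm p (chiE (dOm Q w θ)) ≤
      ENNReal.ofReal C * vnorm p (chiE (dOm Q w θ \ dOm Q w θ')) := by
  let S : ℕ → Set (Fin n → ℝ) := fun j =>
    ⋃ q ∈ dSel Q w θ, (dcube Q (rseq j) (rseq_pos j) q.1 q.2).toSet
  refine vn_lim hp1 (measurableSet_dOm Q w θ) (S := S) ?_ ?_ ?_ ?_
  · intro j
    exact MeasurableSet.biUnion (to_countable _) fun q _ => measurableSet_toSet _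
  · intro i j hij
    exact iUnion₂_mono fun q _ => dcube_mono Q _ _ (rseq_mono hij) _ _
  · have : ∀ q : ℕ × (Fin n → ℤ), ∀ᵐ x ∂(volume : Measure (Fin n → ℝ)), x ∈ dcell Q q.1 q.2 →
      ∃ j, x ∈ (dcube Q (rseq j) (rseq_pos j) q.1 q.2).toSet := fun q => dcell_ae_le_iUnion Q _ _
    filter_upwards [ae_all_iff.2 this] with x hx hxO
    obtain ⟨q, hq, hxq⟩ := exists_dSel hxO
    obtain ⟨j, hj⟩ := hx q hxq
    simp only [S, mem_iUnion]
    exact ⟨j, q, hq, hj⟩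
  · intro j
    let F : Set (RCube n) := (fun q : ℕ × (Fin n → ℤ) =>
      dcube Q (rseq j) (rseq_pos j) q.1 q.2) '' dSel Q w θ
    have hF : PairwiseDisjointCubes F := by
      rintro _ ⟨q, hq, rfl⟩ _ ⟨q', hq', rfl⟩ hne
      refine Set.disjoint_left.2 fun x hx hx' => hne ?_
      have := dSel_unique hq hq' (dcube_subset_dcell Q _ (rseq_lt j) _ _ hx)
        (dcube_subset_dcell Q _ (rseq_lt j) _ _ hx')
      rw [this]
    have key := hA F hF (fun _ => 1) (fun _ _ => zero_le_one)
      (fun R => R.toSet \ dOm Q w θ') ?_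
    · rw [cubeSum_one, cubeSum_one] at key
      have e : S j = ⋃ R ∈ F, R.toSet := by
        simp only [S, F, biUnion_image]
      rw [e]
      refine key.trans ?_
      gcongr
      refine vn_mono hp1 ?_
      simp only [F, biUnion_image]
      refine iUnion₂_subset fun q hq => ?_
      exact sdiff_subset_sdiff_left
        ((dcube_subset_dcell Q _ (rseq_lt j) _ _).trans (dSel_subset hq))
    · rintro _ ⟨q, hq, rfl⟩
      set R := dcube Q (rseq j) (rseq_pos j) q.1 q.2 with hR
      refine ⟨(measurableSet_toSet R).diff (measurableSet_dOm Q w θ'), sdiff_subset, ?_⟩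
      have hcell : volume (dcell Q q.1 q.2) ≤ 2 ^ n * volume R.toSet := by
        rw [hR, volume_dcube, ← mul_assoc, ← mul_pow]
        have : (1 : ℝ≥0∞) ≤ 2 * ENNReal.ofReal (rseq j) := by
          rw [show (2 : ℝ≥0∞) = ENNReal.ofReal 2 by simp, ← ENNReal.ofReal_mul (by norm_num)]
          rw [ENNReal.one_le_ofReal]
          linarith [rseq_half j]
        calc volume (dcell Q q.1 q.2) = 1 * volume (dcell Q q.1 q.2) := (one_mul _).symm
          _ ≤ _ := by
            gcongr
            exact one_le_pow₀ this
      have h1 : θ' * volume (R.toSet ∩ dOm Q w θ') ≤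
          θ' * (ENNReal.ofReal (1 - lam) * volume R.toSet) := by
        calc θ' * volume (R.toSet ∩ dOm Q w θ') ≤ θ' * volume (dOm Q w θ' ∩ dcell Q q.1 q.2) := by
              refine mul_le_mul_right (measure_mono ?_) _
              intro x hx
              exact ⟨hx.2, dcube_subset_dcell Q _ (rseq_lt j) _ _ hx.1⟩
          _ ≤ 2 ^ n * θ * volume (dcell Q q.1 q.2) := dOm_inter_le h h0 hq
          _ ≤ 2 ^ n * θ * (2 ^ n * volume R.toSet) := by gcongr
          _ = (4 ^ n * θ) * volume R.toSet := by
              rw [show (4 : ℝ≥0∞) = 2 * 2 by norm_num, mul_pow]; ring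
          _ ≤ (ENNReal.ofReal (1 - lam) * θ') * volume R.toSet := by gcongr
          _ = _ := by ring
      have h2 : volume (R.toSet ∩ dOm Q w θ') ≤ ENNReal.ofReal (1 - lam) * volume R.toSet :=
        (ENNReal.mul_le_mul_iff_right hθ0 hθt).1 h1
      have h3 := measure_inter_add_sdiff (μ := volume) R.toSet (measurableSet_dOm Q w θ')
      have h4 : ENNReal.ofReal (1 - lam) * volume R.toSet + ENNReal.ofReal lam * volume R.toSet
          = volume R.toSet := by
        rw [← add_mul, ← ENNReal.ofReal_add (by linarith) hl0.le]
        simp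
      have hfin : ENNReal.ofReal (1 - lam) * volume R.toSet ≠ ∞ :=
        ENNReal.mul_ne_top ENNReal.ofReal_ne_top (volume_toSet_ne_top R)
      refine (ENNReal.add_le_add_iff_left hfin).1 ?_
      rw [h4]
      calc volume R.toSet = _ := h3.symm
        _ ≤ _ := by gcongr

/-- Geometric decay from the one-step inequality. -/
lemma halving {n : ℕ} {p : (Fin n → ℝ) → ℝ} (hp1 : ∀ x, 1 ≤ p x) {B : ℝ}
    (hB : ∀ᵐ x ∂(volume : Measure (Fin n → ℝ)), p x ≤ B) {C : ℝ} (hC : 1 ≤ C)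
    {O : ℕ → Set (Fin n → ℝ)} (hO : ∀ k, MeasurableSet (O k)) (hanti : Antitone O)
    (hstep : ∀ k, vnorm p (chiE (O k)) ≤ ENNReal.ofReal C * vnorm p (chiE (O k \ O (k + 1))))
    (hfin : ∀ k, vnorm p (chiE (O k)) ≠ ∞) {M : ℕ} (hM : 2 * (4 * C) ^ B ≤ M) (k : ℕ) :
    vnorm p (chiE (O (k + M))) ≤ vnorm p (chiE (O k)) / 2 := by
  by_contra hc
  push Not at hc
  set N := vnorm p (chiE (O k)) with hN
  have hle : vnorm p (chiE (O (k + M))) ≤ N := vn_mono hp1 (hanti (by omega))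
  have hN0 : N ≠ 0 := (pos_of_gt (hc.trans_le hle)).ne'
  have hNt : N ≠ ∞ := hfin k
  have hCpos : 0 < C := by linarith
  have hC0 : ENNReal.ofReal C ≠ 0 := (ENNReal.ofReal_pos.2 hCpos).ne'
  have hlow : ∀ i < M, 1 ≤ ∫⁻ x in O (k + i) \ O (k + i + 1), (2 * ENNReal.ofReal C * N⁻¹) ^ p x := by
    intro i hi
    by_contra hcc
    push Not at hcc
    have h1 : vnorm p (chiE (O (k + i) \ O (k + i + 1))) ≤ (2 * ENNReal.ofReal C * N⁻¹)⁻¹ := by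
      refine vn_le hp1 ((hO _).diff (hO _)) ?_ ?_
      · rw [ENNReal.inv_pos]
        exact ENNReal.mul_ne_top (ENNReal.mul_ne_top (by norm_num) ENNReal.ofReal_ne_top)
          (ENNReal.inv_ne_top.2 hN0)
      · rw [inv_inv]; exact hcc.le
    have h2 : vnorm p (chiE (O (k + M))) ≤ N / 2 := by
      calc vnorm p (chiE (O (k + M))) ≤ vnorm p (chiE (O (k + i))) :=
            vn_mono hp1 (hanti (by omega))
        _ ≤ ENNReal.ofReal C * vnorm p (chiE (O (k + i) \ O (k + i + 1))) := hstep _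
        _ ≤ ENNReal.ofReal C * (2 * ENNReal.ofReal C * N⁻¹)⁻¹ := by gcongr
        _ = N / 2 := by
          rw [ENNReal.mul_inv (Or.inr (ENNReal.inv_ne_top.2 hN0)) (Or.inr (ENNReal.inv_ne_zero.2 hNt)),
            ENNReal.mul_inv (Or.inl (by norm_num)) (Or.inl (by norm_num)), inv_inv]
          rw [show ENNReal.ofReal C * (2⁻¹ * (ENNReal.ofReal C)⁻¹ * N) =
            (ENNReal.ofReal C * (ENNReal.ofReal C)⁻¹) * (N * 2⁻¹) by ring,
            ENNReal.mul_inv_cancel hC0 ENNReal.ofReal_ne_top, one_mul, div_eq_mul_inv]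
    exact absurd h2 (not_le.2 hc)
  have hup : ∫⁻ x in O k, (2 * N)⁻¹ ^ p x ≤ 1 := by
    refine vn_lt hp1 (hO k) ?_
    rw [← hN, two_mul]
    exact ENNReal.lt_add_right hNt hN0
  have hlow' : ∀ i < M, (ENNReal.ofReal ((4 * C) ^ B))⁻¹ ≤
      ∫⁻ x in O (k + i) \ O (k + i + 1), (2 * N)⁻¹ ^ p x := by
    intro i hi
    rw [ENNReal.inv_le_iff_le_mul (fun _ => (ENNReal.ofReal_pos.2 (by positivity)).ne')
      (fun h => absurd h ENNReal.ofReal_ne_top)]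
    refine (hlow i hi).trans ?_
    rw [← lintegral_const_mul' _ _ ENNReal.ofReal_ne_top]
    refine lintegral_mono_ae ?_
    filter_upwards [ae_restrict_of_ae hB] with x hx
    have e : 2 * ENNReal.ofReal C * N⁻¹ = ENNReal.ofReal (4 * C) * (2 * N)⁻¹ := by
      rw [ENNReal.mul_inv (Or.inl (by norm_num)) (Or.inl (by norm_num)),
        ENNReal.ofReal_mul (by norm_num), show ENNReal.ofReal 4 = 2 * 2 by norm_num]
      rw [show (2 : ℝ≥0∞) * 2 * ENNReal.ofReal C * (2⁻¹ * N⁻¹) =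
        (2 * 2⁻¹) * (2 * ENNReal.ofReal C * N⁻¹) by ring,
        ENNReal.mul_inv_cancel (by norm_num) (by norm_num), one_mul]
    rw [e, ENNReal.mul_rpow_of_nonneg _ _ (zero_le_one.trans (hp1 x)),
      ENNReal.ofReal_rpow_of_pos (by positivity)]
    gcongr
    linarith
  have hdisj : (Finset.range M : Set ℕ).PairwiseDisjoint (fun i => O (k + i) \ O (k + i + 1)) := by
    intro i _ j _ hij
    refine Set.disjoint_left.2 fun x hx hx' => ?_
    rcases lt_or_gt_of_ne hij with h | h
    · exact hx.2 (hanti (by omega) hx'.1)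
    · exact hx'.2 (hanti (by omega) hx.1)
  have hsum : (M : ℝ≥0∞) * (ENNReal.ofReal ((4 * C) ^ B))⁻¹ < 1 + 1 := by
    refine lt_of_le_of_lt ?_ (by norm_num : (1 : ℝ≥0∞) < 1 + 1)
    calc (M : ℝ≥0∞) * (ENNReal.ofReal ((4 * C) ^ B))⁻¹
        = ∑ i ∈ Finset.range M, (ENNReal.ofReal ((4 * C) ^ B))⁻¹ := by simp
      _ ≤ ∑ i ∈ Finset.range M, ∫⁻ x in O (k + i) \ O (k + i + 1), (2 * N)⁻¹ ^ p x :=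
          Finset.sum_le_sum fun i hi => hlow' i (Finset.mem_range.1 hi)
      _ = ∫⁻ x in ⋃ i ∈ Finset.range M, O (k + i) \ O (k + i + 1), (2 * N)⁻¹ ^ p x := by
          rw [lintegral_biUnion_finset hdisj fun i _ => (hO _).diff (hO _)]
      _ ≤ ∫⁻ x in O k, (2 * N)⁻¹ ^ p x := by
          refine lintegral_mono_set (iUnion₂_subset fun i _ => ?_)
          exact sdiff_subset.trans (hanti (by omega))
      _ ≤ 1 := hup
  refine absurd hsum (not_lt.2 ?_)
  have hX : 0 < (4 * C) ^ B := by positivity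
  rw [← div_eq_mul_inv, ENNReal.le_div_iff_mul_le (Or.inl (ENNReal.ofReal_pos.2 hX).ne')
    (Or.inl ENNReal.ofReal_ne_top), one_add_one_eq_two, show (2 : ℝ≥0∞) = ENNReal.ofReal 2 by simp,
    ← ENNReal.ofReal_mul (by norm_num), ← ENNReal.ofReal_natCast]
  exact ENNReal.ofReal_le_ofReal hM


/-! ### Reverse Hölder inequality at the normalizing value -/

lemma dcell_zero_ae {n : ℕ} (Q : RCube n) : dcell Q 0 0 =ᵐ[volume] Q.toSet := by
  have := dcell_ae_eq Q 0 0
  rwa [dcube_zero] at this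

lemma dcell_zero_subset {n : ℕ} (Q : RCube n) : dcell Q 0 0 ⊆ Q.toSet := by
  intro x hx i
  have h := (mem_dcell_iff Q 0 0 x).1 hx i
  rw [dcube_zero] at h
  rw [abs_le]
  simp only [pow_zero, div_one] at h
  exact ⟨h.1, h.2.le⟩

lemma dOm_subset_zero {n : ℕ} (Q : RCube n) (w : (Fin n → ℝ) → ℝ≥0∞) (θ : ℝ≥0∞) :
    dOm Q ((dcell Q 0 0).indicator w) θ ⊆ dcell Q 0 0 := by
  rintro x ⟨m, hm⟩
  by_contra hx
  have : ∫⁻ y in dcell Q m (didx Q m x), (dcell Q 0 0).indicator w y = 0 := by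
    rw [setLIntegral_eq_zero (measurableSet_dcell Q _ _)]
    intro y hy
    refine indicator_of_notMem (fun hy0 => hx ?_) _
    have e1 : didx Q m y = didx Q m x := hy
    have e2 : didx Q 0 y = 0 := hy0
    exact (didx_mono Q (Nat.zero_le m) e1).symm.trans e2
  unfold dbad at hm
  rw [this] at hm
  exact absurd hm (by simp)

lemma not_dbad_zero {n : ℕ} (Q : RCube n) (w : (Fin n → ℝ) → ℝ≥0∞) {θ : ℝ≥0∞}
    (hθ : (∫⁻ x in Q.toSet, w x) / volume Q.toSet ≤ θ) (k : Fin n → ℤ) :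
    ¬ dbad Q ((dcell Q 0 0).indicator w) θ 0 k := by
  intro hb
  have hne : (dcell Q 0 k).Nonempty := nonempty_of_measure_ne_zero (volume_dcell_pos Q _ _).ne'
  obtain ⟨x, hx⟩ := hne
  have e : didx Q 0 x = k := hx
  have hx' : x ∈ dOm Q ((dcell Q 0 0).indicator w) θ := ⟨0, by rw [e]; exact hb⟩
  have e2 : didx Q 0 x = 0 := dOm_subset_zero Q w θ hx'
  have hk : k = 0 := e.symm.trans e2
  subst hk
  unfold dbad at hb
  rw [setLIntegral_indicator (measurableSet_dcell Q _ _), inter_self,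
    setLIntegral_congr (dcell_zero_ae Q), measure_congr (dcell_zero_ae Q)] at hb
  rw [ENNReal.div_le_iff_le_mul (Or.inl (volume_toSet_pos Q).ne')
    (Or.inl (volume_toSet_ne_top Q))] at hθ
  exact absurd hθ (not_le.2 hb)

lemma vn_cube_ne_top {n : ℕ} {p : (Fin n → ℝ) → ℝ} (hp1 : ∀ x, 1 ≤ p x) (Q : RCube n) :
    vnorm p (chiE Q.toSet) ≠ ∞ := by
  have hvt := volume_toSet_ne_top Q
  have hL : (1 : ℝ≥0∞) ≤ max 1 (volume Q.toSet) := le_max_left _ _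
  refine ne_top_of_le_ne_top (b := max 1 (volume Q.toSet)) (by simp [hvt]) ?_
  refine vn_le hp1 (measurableSet_toSet Q) (lt_of_lt_of_le one_pos hL) ?_
  calc ∫⁻ x in Q.toSet, (max 1 (volume Q.toSet))⁻¹ ^ p x
      ≤ ∫⁻ x in Q.toSet, (max 1 (volume Q.toSet))⁻¹ := by
        refine lintegral_mono fun x => ?_
        calc (max 1 (volume Q.toSet))⁻¹ ^ p x ≤ (max 1 (volume Q.toSet))⁻¹ ^ (1 : ℝ) :=
              ENNReal.rpow_le_rpow_of_exponent_ge (ENNReal.inv_le_one.2 hL) (hp1 x)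
          _ = _ := ENNReal.rpow_one _
    _ = (max 1 (volume Q.toSet))⁻¹ * volume Q.toSet := by simp
    _ ≤ 1 := by
        rw [mul_comm, ← div_eq_mul_inv]
        exact ENNReal.div_le_of_le_mul (by rw [one_mul]; exact le_max_right _ _)

lemma vn_cube_ne_zero {n : ℕ} {p : (Fin n → ℝ) → ℝ} (hp1 : ∀ x, 1 ≤ p x) (Q : RCube n) :
    vnorm p (chiE Q.toSet) ≠ 0 := by
  have hvp := volume_toSet_pos Q
  intro h0
  obtain ⟨L, hL0, hL⟩ := exists_between (show (0 : ℝ≥0∞) < min 1 (volume Q.toSet) by simp [hvp])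
  have hL1 : L < 1 := hL.trans_le (min_le_left _ _)
  have hL2 : L < volume Q.toSet := hL.trans_le (min_le_right _ _)
  have h1 := vn_lt hp1 (measurableSet_toSet Q) (L := L) (by rw [h0]; exact hL0)
  have h2 : L⁻¹ * volume Q.toSet ≤ 1 := by
    refine le_trans ?_ h1
    calc L⁻¹ * volume Q.toSet = ∫⁻ x in Q.toSet, L⁻¹ := by simp
      _ ≤ _ := by
        refine lintegral_mono fun x => ?_
        calc L⁻¹ = L⁻¹ ^ (1 : ℝ) := (ENNReal.rpow_one _).symm
          _ ≤ _ := ENNReal.rpow_le_rpow_of_exponent_le (ENNReal.one_le_inv.2 hL1.le) (hp1 x)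
  have h3 : volume Q.toSet ≤ L := by
    rw [mul_comm, ← div_eq_mul_inv, ENNReal.div_le_iff_le_mul (Or.inl hL0.ne')
      (Or.inl (hL1.trans one_lt_top).ne), one_mul] at h2
    exact h2
  exact absurd h3 (not_le.2 hL2)

/-- rescaling of the modular. -/
lemma lintegral_scale_le {n : ℕ} {p : (Fin n → ℝ) → ℝ} (hp1 : ∀ x, 1 ≤ p x) {B : ℝ}
    (hB : ∀ᵐ x ∂(volume : Measure (Fin n → ℝ)), p x ≤ B) (S : Set (Fin n → ℝ))
    {c : ℝ≥0∞} (hc : c ≤ 1) (T : ℝ≥0∞) :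
    ∫⁻ x in S, (2 * c * T) ^ p x ≤ 2 ^ B * c * ∫⁻ x in S, T ^ p x := by
  have h2 : (2 : ℝ≥0∞) ^ B * c ≠ ∞ := by
    refine ENNReal.mul_ne_top ?_ (ne_top_of_le_ne_top one_ne_top hc)
    rw [show (2 : ℝ≥0∞) = ENNReal.ofReal 2 by simp, ENNReal.ofReal_rpow_of_pos (by norm_num)]
    exact ENNReal.ofReal_ne_top
  rw [← lintegral_const_mul' _ _ h2]
  refine lintegral_mono_ae ?_
  filter_upwards [ae_restrict_of_ae hB] with x hx
  have hp0 : 0 ≤ p x := zero_le_one.trans (hp1 x)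
  rw [ENNReal.mul_rpow_of_nonneg _ _ hp0, ENNReal.mul_rpow_of_nonneg _ _ hp0]
  gcongr
  · norm_num
  · calc c ^ p x ≤ c ^ (1 : ℝ) := ENNReal.rpow_le_rpow_of_exponent_ge hc (hp1 x)
      _ = c := ENNReal.rpow_one _

lemma two_rpow_ne_top (B : ℝ) : (2 : ℝ≥0∞) ^ B ≠ ∞ := by
  rw [show (2 : ℝ≥0∞) = ENNReal.ofReal 2 by simp, ENNReal.ofReal_rpow_of_pos (by norm_num)]
  exact ENNReal.ofReal_ne_top

lemma w_upper {n : ℕ} {p : (Fin n → ℝ) → ℝ} (hp1 : ∀ x, 1 ≤ p x) {B : ℝ}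
    (hB : ∀ᵐ x ∂(volume : Measure (Fin n → ℝ)), p x ≤ B) {S : Set (Fin n → ℝ)}
    (hS : MeasurableSet S) {N : ℝ≥0∞} (hN0 : N ≠ 0) (hNt : N ≠ ∞) {c : ℝ≥0∞} (hc : c ≤ 1)
    (hc0 : c ≠ 0) (h : vnorm p (chiE S) ≤ c * N) : ∫⁻ x in S, N⁻¹ ^ p x ≤ 2 ^ B * c := by
  have hct : c ≠ ∞ := ne_top_of_le_ne_top one_ne_top hc
  have h1 : ∫⁻ x in S, (2 * c * N)⁻¹ ^ p x ≤ 1 := by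
    refine vn_lt hp1 hS (h.trans_lt ?_)
    rw [mul_assoc, two_mul]
    exact ENNReal.lt_add_right (ENNReal.mul_ne_top hct hNt) (mul_ne_zero hc0 hN0)
  have h2 := lintegral_scale_le hp1 hB S hc ((2 * c * N)⁻¹)
  have e : 2 * c * (2 * c * N)⁻¹ = N⁻¹ := by
    have h3 : 2 * c ≠ 0 := mul_ne_zero (by norm_num) hc0
    have h4 : 2 * c ≠ ∞ := ENNReal.mul_ne_top (by norm_num) hct
    rw [ENNReal.mul_inv (Or.inl h3) (Or.inl h4), ← mul_assoc, ENNReal.mul_inv_cancel h3 h4, one_mul]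
  rw [e] at h2
  refine h2.trans ?_
  calc 2 ^ B * c * ∫⁻ x in S, (2 * c * N)⁻¹ ^ p x ≤ 2 ^ B * c * 1 := by gcongr
    _ = _ := mul_one _

lemma w_lower {n : ℕ} {p : (Fin n → ℝ) → ℝ} (hp1 : ∀ x, 1 ≤ p x) {B : ℝ}
    (hB : ∀ᵐ x ∂(volume : Measure (Fin n → ℝ)), p x ≤ B) (Q : RCube n) :
    1 ≤ 2 ^ B * ∫⁻ x in Q.toSet, (vnorm p (chiE Q.toSet))⁻¹ ^ p x := by
  have hN0 := vn_cube_ne_zero hp1 Q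
  have hNt := vn_cube_ne_top hp1 Q
  by_contra hc
  push Not at hc
  set N := vnorm p (chiE Q.toSet) with hN
  have h2 := lintegral_scale_le hp1 hB Q.toSet le_rfl (N⁻¹)
  rw [mul_one, mul_one] at h2
  have h3 : N ≤ (2 * N⁻¹)⁻¹ := by
    refine vn_le hp1 (measurableSet_toSet Q) ?_ ?_
    · rw [ENNReal.inv_pos]
      exact ENNReal.mul_ne_top (by norm_num) (ENNReal.inv_ne_top.2 hN0)
    · rw [inv_inv]
      exact h2.trans hc.le
  rw [ENNReal.mul_inv (Or.inl (by norm_num)) (Or.inl (by norm_num)), inv_inv, mul_comm,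
    ← div_eq_mul_inv] at h3
  exact absurd h3 (not_le.2 (ENNReal.half_lt_self hN0 hNt))

/-- Layer-cake step. -/
lemma layer {X : Type*} [MeasurableSpace X] {μ : Measure X} {w : X → ℝ≥0∞} (hw : Measurable w)
    (hwt : ∀ x, w x ≠ ∞) {A : ℝ≥0∞} (hA0 : A ≠ 0) (hAt : A ≠ ∞) {a : ℝ} (ha : 1 < a) {δ b : ℝ}
    (hδ : 0 < δ) (hb : a ^ δ = b) {P : ℕ → Set X} (hP : ∀ j, MeasurableSet (P j))
    (hmem : ∀ᵐ x ∂μ, ∀ j, ENNReal.ofReal (a ^ j) * A < w x → x ∈ P j) :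
    ∫⁻ x, w x ^ (1 + δ) ∂μ ≤ A ^ δ * (∫⁻ x, w x ∂μ +
      ∑' j, ENNReal.ofReal (b ^ (j + 1)) * ∫⁻ x in P j, w x ∂μ) := by
  have hb0 : 0 < b := by rw [← hb]; positivity
  have hpt : ∀ᵐ x ∂μ, w x ^ (1 + δ) ≤ A ^ δ * (w x +
      ∑' j, ENNReal.ofReal (b ^ (j + 1)) * (P j).indicator w x) := by
    filter_upwards [hmem] with x hx
    rw [ENNReal.rpow_add_of_nonneg _ _ zero_le_one hδ.le, ENNReal.rpow_one]
    have hex : ∃ j : ℕ, w x ≤ ENNReal.ofReal (a ^ j) * A := by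
      have hq : w x / A ≠ ∞ := ENNReal.div_ne_top (hwt x) hA0
      obtain ⟨j, hj⟩ := pow_unbounded_of_one_lt (w x / A).toReal ha
      refine ⟨j, ?_⟩
      rw [← ENNReal.div_le_iff_le_mul (Or.inl hA0) (Or.inl hAt)]
      exact ENNReal.le_ofReal_iff_toReal_le hq (by positivity) |>.2 hj.le
    classical
    have hspec := Nat.find_spec hex
    rcases hj : Nat.find hex with _ | j
    · rw [hj] at hspec
      simp only [pow_zero, ENNReal.ofReal_one, one_mul] at hspec
      calc w x * w x ^ δ ≤ w x * A ^ δ := by gcongr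
        _ = A ^ δ * w x := mul_comm _ _
        _ ≤ _ := by gcongr; exact le_self_add
    · have hlt := Nat.find_min hex (m := j) (by omega)
      push Not at hlt
      have hxP := hx j hlt
      rw [hj] at hspec
      have h1 : w x ^ δ ≤ ENNReal.ofReal (b ^ (j + 1)) * A ^ δ := by
        calc w x ^ δ ≤ (ENNReal.ofReal (a ^ (j + 1)) * A) ^ δ := by gcongr
          _ = _ := by
            rw [ENNReal.mul_rpow_of_nonneg _ _ hδ.le, ENNReal.ofReal_rpow_of_pos (by positivity),
              ← hb, ← Real.rpow_natCast, ← Real.rpow_natCast, ← Real.rpow_mul (by positivity),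
              ← Real.rpow_mul (by positivity), mul_comm δ]
      calc w x * w x ^ δ ≤ w x * (ENNReal.ofReal (b ^ (j + 1)) * A ^ δ) := by gcongr
        _ = A ^ δ * (ENNReal.ofReal (b ^ (j + 1)) * (P j).indicator w x) := by
            rw [indicator_of_mem hxP]; ring
        _ ≤ _ := by
            gcongr
            exact (ENNReal.le_tsum j).trans le_add_self
  refine (lintegral_mono_ae hpt).trans (le_of_eq ?_)
  have hm : ∀ j, Measurable fun x => ENNReal.ofReal (b ^ (j + 1)) * (P j).indicator w x :=
    fun j => (hw.indicator (hP j)).const_mul _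
  rw [lintegral_const_mul' _ _ (ENNReal.rpow_ne_top_of_nonneg hδ.le hAt), lintegral_add_left hw,
    lintegral_tsum fun j => (hm j).aemeasurable]
  congr 3
  funext j
  rw [lintegral_const_mul _ (hw.indicator (hP j)), lintegral_indicator (hP j)]

lemma rh_main {n : ℕ} {p : (Fin n → ℝ) → ℝ} (hpm : Measurable p) (hp1 : ∀ x, 1 ≤ p x) {B : ℝ}
    (hB : ∀ᵐ x ∂(volume : Measure (Fin n → ℝ)), p x ≤ B) {lam C : ℝ}
    (hl0 : 0 < lam) (hl1 : lam < 1) (hA : AInftyWith p lam C) :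
    ∃ γ : ℝ, 1 < γ ∧ ∃ K : ℝ, 1 < K ∧ ∀ Q : RCube n,
      (∫⁻ x in Q.toSet, (vnorm p (chiE Q.toSet))⁻¹ ^ (γ * p x)) / volume Q.toSet ≤
        ENNReal.ofReal K *
          ((∫⁻ x in Q.toSet, (vnorm p (chiE Q.toSet))⁻¹ ^ p x) / volume Q.toSet) ^ γ := by
  set C' := max C 1 with hC'
  have hA' : AInftyWith p lam C' := by
    intro F hF t ht E hE
    refine (hA F hF t ht E hE).trans ?_
    gcongr
    exact le_max_left _ _
  have hC1 : 1 ≤ C' := le_max_right _ _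
  set a : ℝ := max 2 (4 ^ n / (1 - lam)) with ha
  have ha2 : 2 ≤ a := le_max_left _ _
  have ha4 : 4 ^ n ≤ (1 - lam) * a := by
    have h1 : 4 ^ n / (1 - lam) ≤ a := le_max_right _ _
    rw [div_le_iff₀ (by linarith)] at h1
    linarith
  obtain ⟨M, hM⟩ := exists_nat_ge (max 1 (2 * (4 * C') ^ B))
  have hM1 : (1 : ℝ) ≤ M := (le_max_left _ _).trans hM
  have hM2 : 2 * (4 * C') ^ B ≤ M := (le_max_right _ _).trans hM
  have hMn : M ≠ 0 := by rintro rfl; norm_num at hM1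
  set α : ℝ := a ^ M with hα
  have hα1 : 1 < α := one_lt_pow₀ (by linarith) hMn
  set δ : ℝ := Real.logb α (3 / 2) with hδ
  have hδ0 : 0 < δ := Real.logb_pos hα1 (by norm_num)
  have hαδ : α ^ δ = 3 / 2 := Real.rpow_logb (by linarith) hα1.ne' (by norm_num)
  have h2B : (2 : ℝ≥0∞) ^ B = ENNReal.ofReal (2 ^ B) := by
    rw [show (2 : ℝ≥0∞) = ENNReal.ofReal 2 by simp, ENNReal.ofReal_rpow_of_pos (by norm_num)]
  refine ⟨1 + δ, by linarith, 1 + 6 * (2 ^ B * 2 ^ B), ?_, fun Q => ?_⟩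
  · have : (0 : ℝ) < 2 ^ B := by positivity
    nlinarith [mul_pos this this]
  have hN0 := vn_cube_ne_zero hp1 Q
  have hNt := vn_cube_ne_top hp1 Q
  have hlow := w_lower hp1 hB Q
  have hupp := w_upper hp1 hB (measurableSet_toSet Q) hN0 hNt le_rfl one_ne_zero
    (by rw [one_mul])
  set N := vnorm p (chiE Q.toSet) with hN
  set w : (Fin n → ℝ) → ℝ≥0∞ := fun x => N⁻¹ ^ p x with hw
  have hwm : Measurable w := measurable_const.pow hpm
  have hwt : ∀ x, w x ≠ ∞ := fun x => ENNReal.rpow_ne_top_of_nonneg (zero_le_one.trans (hp1 x))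
    (ENNReal.inv_ne_top.2 hN0)
  set W := ∫⁻ x in Q.toSet, w x with hW
  set D := dcell Q 0 0 with hD
  have hDm : MeasurableSet D := measurableSet_dcell Q 0 0
  have hWD : ∫⁻ x in D, w x = W := setLIntegral_congr (dcell_zero_ae Q)
  have hW0 : W ≠ 0 := by
    intro h
    rw [h, mul_zero] at hlow
    exact absurd hlow (by norm_num)
  have hWt : W ≠ ∞ := ne_top_of_le_ne_top
    (ENNReal.mul_ne_top (two_rpow_ne_top B) one_ne_top) hupp
  have hV0 := (volume_toSet_pos Q).ne'
  have hVt := volume_toSet_ne_top Q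
  set A := W / volume Q.toSet with hAdef
  have hA0 : A ≠ 0 := (ENNReal.div_pos hW0 hVt).ne'
  have hAt : A ≠ ∞ := ENNReal.div_ne_top hWt hV0
  let O : ℕ → Set (Fin n → ℝ) := fun k => dOm Q (D.indicator w) (ENNReal.ofReal (a ^ k) * A)
  have hOm : ∀ k, MeasurableSet (O k) := fun k => measurableSet_dOm _ _ _
  have hanti : Antitone O := by
    intro i j hij
    refine dOm_anti ?_
    gcongr
    linarith
  have hOD : ∀ k, O k ⊆ D := fun k => dOm_subset_zero _ _ _
  have hON : ∀ k, vnorm p (chiE (O k)) ≤ N :=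
    fun k => vn_mono hp1 ((hOD k).trans (dcell_zero_subset Q))
  have hstep : ∀ k, vnorm p (chiE (O k)) ≤
      ENNReal.ofReal C' * vnorm p (chiE (O k \ O (k + 1))) := by
    intro k
    refine ainf_step hp1 hl0 hl1 hA' Q _ ?_ ?_ ?_ ?_ ?_
    · gcongr
      · linarith
      · omega
    · refine not_dbad_zero Q w ?_
      calc W / volume Q.toSet = 1 * A := by rw [one_mul]
        _ ≤ _ := by
          gcongr
          rw [ENNReal.one_le_ofReal]
          exact one_le_pow₀ (by linarith)
    · exact mul_ne_zero (ENNReal.ofReal_pos.2 (by positivity)).ne' hA0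
    · exact ENNReal.mul_ne_top ENNReal.ofReal_ne_top hAt
    · rw [← mul_assoc, ← mul_assoc, show (4 : ℝ≥0∞) = ENNReal.ofReal 4 by norm_num,
        ← ENNReal.ofReal_pow (by norm_num), ← ENNReal.ofReal_mul (by positivity),
        ← ENNReal.ofReal_mul (by linarith)]
      refine mul_le_mul_left (ENNReal.ofReal_le_ofReal ?_) _
      rw [pow_succ]
      have : 0 < a ^ k := by positivity
      nlinarith [mul_le_mul_of_nonneg_right ha4 this.le]
  have hhalf : ∀ k, vnorm p (chiE (O (k + M))) ≤ vnorm p (chiE (O k)) / 2 :=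
    halving hp1 hB hC1 hOm hanti hstep (fun k => ne_top_of_le_ne_top hNt (hON k)) hM2
  have hdec : ∀ j, vnorm p (chiE (O (j * M))) ≤ 2⁻¹ ^ j * N := by
    intro j
    induction j with
    | zero => simpa using hON 0
    | succ j ih =>
      rw [Nat.succ_mul]
      refine (hhalf _).trans ?_
      rw [div_eq_mul_inv, pow_succ]
      calc vnorm p (chiE (O (j * M))) * 2⁻¹ ≤ (2⁻¹ ^ j * N) * 2⁻¹ := by gcongr
        _ = _ := by ring
  have hwO : ∀ j, ∫⁻ x in O (j * M), w x ≤ 2 ^ B * 2⁻¹ ^ j := by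
    intro j
    refine w_upper hp1 hB (hOm _) hN0 hNt ?_ ?_ (hdec j)
    · exact pow_le_one₀ (by simp) (by simp)
    · exact pow_ne_zero _ (by simp)
  have hmem : ∀ᵐ x ∂(volume.restrict D), ∀ j : ℕ,
      ENNReal.ofReal (α ^ j) * A < w x → x ∈ O (j * M) := by
    have h1 := ae_mem_dOm Q (hwm.indicator hDm)
      (by rw [lintegral_indicator hDm, hWD]; exact hWt)
    filter_upwards [ae_restrict_of_ae h1, ae_restrict_mem hDm] with x hx hxD j hj
    refine hx _ ?_
    rw [indicator_of_mem hxD, mul_comm j M, pow_mul]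
    exact hj
  have hlay := layer hwm hwt hA0 hAt hα1 hδ0 hαδ (fun j => hOm (j * M)) hmem
  have hI : ∫⁻ x in Q.toSet, N⁻¹ ^ ((1 + δ) * p x) = ∫⁻ x in D, w x ^ (1 + δ) := by
    rw [setLIntegral_congr (dcell_zero_ae Q)]
    refine lintegral_congr fun x => ?_
    rw [mul_comm, ENNReal.rpow_mul]
  have hsum : ∑' j : ℕ, ENNReal.ofReal ((3 / 2) ^ (j + 1)) * ∫⁻ x in O (j * M), w x ∂(volume.restrict D)
      ≤ ENNReal.ofReal (6 * (2 ^ B * 2 ^ B)) * W := by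
    calc _ ≤ ∑' j : ℕ, ENNReal.ofReal (3 / 4) ^ j * (ENNReal.ofReal (3 / 2 * (2 ^ B * 2 ^ B)) * W) := by
          refine ENNReal.tsum_le_tsum fun j => ?_
          have h1 : ∫⁻ x in O (j * M), w x ∂(volume.restrict D) ≤ 2 ^ B * 2⁻¹ ^ j * (2 ^ B * W) := by
            calc _ ≤ ∫⁻ x in O (j * M), w x :=
                  lintegral_mono' (Measure.restrict_mono subset_rfl Measure.restrict_le_self) le_rfl
              _ ≤ 2 ^ B * 2⁻¹ ^ j * 1 := by rw [mul_one]; exact hwO j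
              _ ≤ _ := by gcongr
          calc _ ≤ ENNReal.ofReal ((3 / 2) ^ (j + 1)) * (2 ^ B * 2⁻¹ ^ j * (2 ^ B * W)) := by gcongr
            _ = _ := by
              rw [h2B, show (2 : ℝ≥0∞)⁻¹ = ENNReal.ofReal 2⁻¹ by
                rw [ENNReal.ofReal_inv_of_pos (by norm_num)]; simp]
              rw [show (3 / 4 : ℝ) = 3 / 2 * 2⁻¹ by norm_num, pow_succ,
                ENNReal.ofReal_mul (by positivity), ENNReal.ofReal_mul (by positivity),
                ENNReal.ofReal_mul (by positivity), ENNReal.ofReal_mul (by positivity),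
                ENNReal.ofReal_pow (by positivity), mul_pow]
              ring
      _ = _ := by
          rw [ENNReal.tsum_mul_right, ENNReal.tsum_geometric]
          rw [show (1 : ℝ≥0∞) - ENNReal.ofReal (3 / 4) = ENNReal.ofReal (1 / 4) by
            rw [← ENNReal.ofReal_one, ← ENNReal.ofReal_sub _ (by norm_num)]; norm_num]
          rw [← ENNReal.ofReal_inv_of_pos (by norm_num), ← mul_assoc,
            ← ENNReal.ofReal_mul (by norm_num)]
          congr 2
          ring
  rw [hI]
  calc (∫⁻ x in D, w x ^ (1 + δ)) / volume Q.toSet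
      ≤ (A ^ δ * (W + ENNReal.ofReal (6 * (2 ^ B * 2 ^ B)) * W)) / volume Q.toSet := by
        gcongr
        refine hlay.trans ?_
        rw [hWD]
        gcongr
    _ = ENNReal.ofReal (1 + 6 * (2 ^ B * 2 ^ B)) * A ^ (1 + δ) := by
        rw [ENNReal.rpow_add _ _ hA0 hAt, ENNReal.rpow_one,
          ENNReal.ofReal_add (by norm_num) (by positivity), ENNReal.ofReal_one, hAdef,
          div_eq_mul_inv, div_eq_mul_inv]
        ring


/-! ### Convexity and conclusion -/

/-- A convexity lemma: reverse Hölder at one point propagates to the segment (positive side). -/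
lemma convex_aux_pos {a : ℝ → ℝ} (ha : ConvexOn ℝ univ a) (ha0 : a 0 = 0) {g s0 κ : ℝ}
    (hg : 1 < g) (hs0 : 0 < s0) (h : a (g * (g * s0)) ≤ g * (g * a s0) + κ) {s : ℝ}
    (hs : 0 < s) (hs' : s ≤ g * s0) : a (g * s) ≤ g * a s + κ := by
  set s1 := g * s0 with hs1
  have hd : 0 < g * s1 - s := by nlinarith
  have hcv : ∀ x y α β : ℝ, 0 ≤ α → 0 ≤ β → α + β = 1 →
      a (α * x + β * y) ≤ α * a x + β * a y := fun x y α β h1 h2 h3 =>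
    ha.2 (mem_univ x) (mem_univ y) h1 h2 h3
  have h1 := hcv s (g * s1) (1 - (g - 1) * s / (g * s1 - s)) ((g - 1) * s / (g * s1 - s))
    (by rw [sub_nonneg, div_le_one hd]; nlinarith)
    (div_nonneg (mul_nonneg (by linarith) hs.le) hd.le) (by ring)
  have h2 := hcv s (g * s1) (1 - (s1 - s) / (g * s1 - s)) ((s1 - s) / (g * s1 - s))
    (by rw [sub_nonneg, div_le_one hd]; nlinarith)
    (div_nonneg (by linarith) hd.le) (by ring)
  have h3 := hcv s1 0 (1 / g) (1 - 1 / g)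
    (by positivity) (by rw [sub_nonneg, div_le_one (by linarith)]; exact hg.le) (by ring)
  have e1 : (1 - (g - 1) * s / (g * s1 - s)) * s + (g - 1) * s / (g * s1 - s) * (g * s1) = g * s := by
    field_simp
    ring
  have e2 : (1 - (s1 - s) / (g * s1 - s)) * s + (s1 - s) / (g * s1 - s) * (g * s1) = s1 := by
    have h0 : (s1 - s) / (g * s1 - s) * (g * s1 - s) = s1 - s := div_mul_cancel₀ _ hd.ne'
    linear_combination h0
  have e3 : 1 / g * s1 + (1 - 1 / g) * 0 = s0 := by
    rw [hs1]; field_simp; ring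
  rw [e1] at h1
  rw [e2] at h2
  rw [e3, ha0] at h3
  have h4 : g * a s0 ≤ a s1 := by
    have h5 := mul_le_mul_of_nonneg_left h3 (by linarith : 0 ≤ g)
    have e4 : g * (1 / g * a s1 + (1 - 1 / g) * 0) = a s1 := by field_simp; ring
    linarith
  have hr : (g - 1) * s / (g * s1 - s) = 1 - g * ((s1 - s) / (g * s1 - s)) := by
    field_simp
    ring
  rw [hr] at h1
  have h6 := mul_le_mul_of_nonneg_left h2 (by linarith : 0 ≤ g)
  have h7 := mul_le_mul_of_nonneg_left h4 (by linarith : 0 ≤ g)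
  nlinarith

lemma convex_aux {a : ℝ → ℝ} (ha : ConvexOn ℝ univ a) (ha0 : a 0 = 0) {g s0 κ : ℝ}
    (hg : 1 < g) (hκ : 0 ≤ κ) (h : a (g * (g * s0)) ≤ g * (g * a s0) + κ) {s : ℝ}
    (hs : s ∈ uIcc 0 (g * s0)) : a (g * s) ≤ g * a s + κ := by
  rcases eq_or_ne s 0 with rfl | hsne
  · simp [ha0, hκ]
  rw [mem_uIcc] at hs
  rcases hs with ⟨h1, h2⟩ | ⟨h1, h2⟩
  · have hs : 0 < s := lt_of_le_of_ne h1 hsne.symm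
    exact convex_aux_pos ha ha0 hg (by nlinarith) h hs h2
  · have hs : s < 0 := lt_of_le_of_ne h2 hsne
    have hc : ConvexOn ℝ univ (fun x => a (-x)) := by
      refine ⟨convex_univ, fun x _ y _ u v hu hv huv => ?_⟩
      have := ha.2 (mem_univ (-x)) (mem_univ (-y)) hu hv huv
      simp only [smul_eq_mul] at this ⊢
      rwa [show -(u * x + v * y) = u * -x + v * -y by ring]
    have := convex_aux_pos (a := fun x => a (-x)) hc (by simpa using ha0) hg
      (s0 := -s0) (by nlinarith) (κ := κ) (by simpa using h) (s := -s) (by linarith) (by linarith)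
    simpa using this

/-- The averaged modular as a function of the logarithm. -/
def phi {n : ℕ} (p : (Fin n → ℝ) → ℝ) (Q : RCube n) (s : ℝ) : ℝ≥0∞ :=
  (∫⁻ x in Q.toSet, ENNReal.ofReal (Real.exp s) ^ p x) / volume Q.toSet

lemma phi_ne_zero {n : ℕ} {p : (Fin n → ℝ) → ℝ} (hpm : Measurable p) (Q : RCube n) (s : ℝ) :
    phi p Q s ≠ 0 := by
  refine (ENNReal.div_pos ?_ (volume_toSet_ne_top Q)).ne'
  have hm : Measurable fun x => ENNReal.ofReal (Real.exp s) ^ p x := measurable_const.pow hpm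
  have hpos : ∀ x, ENNReal.ofReal (Real.exp s) ^ p x ≠ 0 := fun x =>
    (ENNReal.rpow_pos (ENNReal.ofReal_pos.2 (Real.exp_pos s)) ENNReal.ofReal_ne_top).ne'
  rw [← pos_iff_ne_zero, lintegral_pos_iff_support hm]
  have : (Function.support fun x => ENNReal.ofReal (Real.exp s) ^ p x) = univ := by
    ext x; simpa using hpos x
  rw [this, Measure.restrict_apply_univ]
  exact volume_toSet_pos Q

lemma phi_ne_top {n : ℕ} {p : (Fin n → ℝ) → ℝ} (hp1 : ∀ x, 1 ≤ p x) {B : ℝ}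
    (hB : ∀ᵐ x ∂(volume : Measure (Fin n → ℝ)), p x ≤ B) (Q : RCube n) (s : ℝ) :
    phi p Q s ≠ ∞ := by
  refine ENNReal.div_ne_top ?_ (volume_toSet_pos Q).ne'
  have hle : ∫⁻ x in Q.toSet, ENNReal.ofReal (Real.exp s) ^ p x ≤
      ∫⁻ x in Q.toSet, ENNReal.ofReal (Real.exp (|s| * B)) := by
    refine lintegral_mono_ae ?_
    filter_upwards [ae_restrict_of_ae hB] with x hx
    rw [ENNReal.ofReal_rpow_of_pos (Real.exp_pos s), ← Real.exp_mul]
    refine ENNReal.ofReal_le_ofReal (Real.exp_le_exp.2 ?_)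
    have := hp1 x
    calc s * p x ≤ |s| * p x := mul_le_mul_of_nonneg_right (le_abs_self s) (by linarith)
      _ ≤ |s| * B := mul_le_mul_of_nonneg_left hx (abs_nonneg s)
  refine ne_top_of_le_ne_top ?_ hle
  rw [setLIntegral_const]
  exact ENNReal.mul_ne_top ENNReal.ofReal_ne_top (volume_toSet_ne_top Q)

lemma phi_zero {n : ℕ} {p : (Fin n → ℝ) → ℝ} (Q : RCube n) : phi p Q 0 = 1 := by
  simp only [phi, Real.exp_zero, ENNReal.ofReal_one, ENNReal.one_rpow, lintegral_one,
    Measure.restrict_apply_univ]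
  exact ENNReal.div_self (volume_toSet_pos Q).ne' (volume_toSet_ne_top Q)

lemma phi_log_convex {n : ℕ} {p : (Fin n → ℝ) → ℝ} (hpm : Measurable p) (Q : RCube n)
    {s t u v : ℝ} (hu : 0 ≤ u) (hv : 0 ≤ v) (huv : u + v = 1) :
    phi p Q (u * s + v * t) ≤ phi p Q s ^ u * phi p Q t ^ v := by
  have hV0 := (volume_toSet_pos Q).ne'
  have hVt := volume_toSet_ne_top Q
  have hm : ∀ s : ℝ, AEMeasurable (fun x => ENNReal.ofReal (Real.exp s) ^ p x)
      (volume.restrict Q.toSet) := fun s => (measurable_const.pow hpm).aemeasurable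
  have h := ENNReal.lintegral_mul_norm_pow_le (hm s) (hm t) hu hv huv
  have e : ∀ x, ENNReal.ofReal (Real.exp (u * s + v * t)) ^ p x =
      (ENNReal.ofReal (Real.exp s) ^ p x) ^ u * (ENNReal.ofReal (Real.exp t) ^ p x) ^ v := by
    intro x
    rw [ENNReal.ofReal_rpow_of_pos (Real.exp_pos _), ENNReal.ofReal_rpow_of_pos (Real.exp_pos _),
      ENNReal.ofReal_rpow_of_pos (Real.exp_pos _),
      ENNReal.ofReal_rpow_of_pos (Real.rpow_pos_of_pos (Real.exp_pos _) _),
      ENNReal.ofReal_rpow_of_pos (Real.rpow_pos_of_pos (Real.exp_pos _) _),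
      ← ENNReal.ofReal_mul (by positivity)]
    congr 1
    rw [← Real.exp_mul, ← Real.exp_mul, ← Real.exp_mul, ← Real.exp_mul, ← Real.exp_mul,
      ← Real.exp_add]
    congr 1
    ring
  unfold phi
  rw [ENNReal.div_rpow_of_nonneg _ _ hu, ENNReal.div_rpow_of_nonneg _ _ hv]
  have hvol : volume Q.toSet = volume Q.toSet ^ u * volume Q.toSet ^ v := by
    rw [← ENNReal.rpow_add _ _ hV0 hVt, huv, ENNReal.rpow_one]
  have hVu0 : volume Q.toSet ^ u ≠ 0 := (ENNReal.rpow_pos (volume_toSet_pos Q) hVt).ne'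
  have hVut : volume Q.toSet ^ u ≠ ∞ := ENNReal.rpow_ne_top_of_nonneg hu hVt
  calc (∫⁻ x in Q.toSet, ENNReal.ofReal (Real.exp (u * s + v * t)) ^ p x) / volume Q.toSet
      ≤ ((∫⁻ x in Q.toSet, ENNReal.ofReal (Real.exp s) ^ p x) ^ u *
          (∫⁻ x in Q.toSet, ENNReal.ofReal (Real.exp t) ^ p x) ^ v) / volume Q.toSet := by
        refine ENNReal.div_le_div_right (le_trans (le_of_eq (lintegral_congr e)) h) _
    _ = _ := by
        rw [div_eq_mul_inv, div_eq_mul_inv, div_eq_mul_inv]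
        have hinv : (volume Q.toSet)⁻¹ = (volume Q.toSet ^ u)⁻¹ * (volume Q.toSet ^ v)⁻¹ := by
          rw [← ENNReal.mul_inv (Or.inl hVu0) (Or.inl hVut), ← hvol]
        rw [hinv]
        ring

lemma log_phi_convex {n : ℕ} {p : (Fin n → ℝ) → ℝ} (hpm : Measurable p) (hp1 : ∀ x, 1 ≤ p x)
    {B : ℝ} (hB : ∀ᵐ x ∂(volume : Measure (Fin n → ℝ)), p x ≤ B) (Q : RCube n) :
    ConvexOn ℝ univ fun s => Real.log (phi p Q s).toReal := by
  have hpos : ∀ s, 0 < (phi p Q s).toReal := fun s =>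
    ENNReal.toReal_pos (phi_ne_zero hpm Q s) (phi_ne_top hp1 hB Q s)
  refine ⟨convex_univ, fun s _ t _ u v hu hv huv => ?_⟩
  simp only [smul_eq_mul]
  have h := phi_log_convex hpm Q (s := s) (t := t) hu hv huv
  have h' := ENNReal.toReal_mono (ENNReal.mul_ne_top
    (ENNReal.rpow_ne_top_of_nonneg hu (phi_ne_top hp1 hB Q s))
    (ENNReal.rpow_ne_top_of_nonneg hv (phi_ne_top hp1 hB Q t))) h
  rw [ENNReal.toReal_mul, ← ENNReal.toReal_rpow, ← ENNReal.toReal_rpow] at h'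
  refine (Real.log_le_log (hpos _) h').trans (le_of_eq ?_)
  rw [Real.log_mul (Real.rpow_pos_of_pos (hpos s) u).ne' (Real.rpow_pos_of_pos (hpos t) v).ne',
    Real.log_rpow (hpos s), Real.log_rpow (hpos t)]

/-- Comparison of `phi` values through logarithms. -/
lemma phi_le_iff {n : ℕ} {p : (Fin n → ℝ) → ℝ} (hpm : Measurable p) (hp1 : ∀ x, 1 ≤ p x)
    {B : ℝ} (hB : ∀ᵐ x ∂(volume : Measure (Fin n → ℝ)), p x ≤ B) (Q : RCube n) {s t K g : ℝ}
    (hK : 0 < K) (hg : 0 ≤ g) : phi p Q s ≤ ENNReal.ofReal K * phi p Q t ^ g ↔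
      Real.log (phi p Q s).toReal ≤ g * Real.log (phi p Q t).toReal + Real.log K := by
  have hpos : ∀ s, 0 < (phi p Q s).toReal := fun s =>
    ENNReal.toReal_pos (phi_ne_zero hpm Q s) (phi_ne_top hp1 hB Q s)
  have hr : 0 < (phi p Q t).toReal ^ g := Real.rpow_pos_of_pos (hpos t) g
  rw [← ENNReal.toReal_le_toReal (phi_ne_top hp1 hB Q s) (ENNReal.mul_ne_top ENNReal.ofReal_ne_top
    (ENNReal.rpow_ne_top_of_nonneg hg (phi_ne_top hp1 hB Q t))), ENNReal.toReal_mul,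
    ENNReal.toReal_ofReal hK.le, ← ENNReal.toReal_rpow,
    ← Real.log_le_log_iff (hpos s) (mul_pos hK hr), Real.log_mul hK.ne' hr.ne',
    Real.log_rpow (hpos t), add_comm]

lemma phi_gamma {n : ℕ} {p : (Fin n → ℝ) → ℝ} (Q : RCube n) (g s : ℝ) :
    (∫⁻ x in Q.toSet, ENNReal.ofReal (Real.exp s) ^ (g * p x)) / volume Q.toSet =
      phi p Q (g * s) := by
  unfold phi
  congr 1
  refine lintegral_congr fun x => ?_
  rw [ENNReal.ofReal_rpow_of_pos (Real.exp_pos _), ENNReal.ofReal_rpow_of_pos (Real.exp_pos _),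
    ← Real.exp_mul, ← Real.exp_mul]
  congr 2
  ring


theorem statement6 {n : ℕ} (p : (Fin n → ℝ) → ℝ) (hpm : Measurable p)
    (hp1 : ∀ x, 1 ≤ p x)
    (hup : ∃ B : ℝ, ∀ᵐ x ∂(volume : Measure (Fin n → ℝ)), p x ≤ B)
    (hA : AInfty p) :
    ∃ γ : ℝ, 1 < γ ∧ ∃ C : ℝ, 1 < C ∧ ∃ ε : ℝ, 0 < ε ∧
      ∀ Q : RCube n, ∀ t : ℝ,
        ENNReal.ofReal t ∈
          Icc (min 1 (vnorm p (chiE Q.toSet) ^ (-(1 + ε))))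
            (max 1 (vnorm p (chiE Q.toSet) ^ (-(1 + ε)))) →
        ((∫⁻ x in Q.toSet, ENNReal.ofReal t ^ (γ * p x)) / volume Q.toSet) ^ (1 / γ) ≤
          ENNReal.ofReal C * ((∫⁻ x in Q.toSet, ENNReal.ofReal t ^ p x) / volume Q.toSet) := by
  obtain ⟨B, hB⟩ := hup
  obtain ⟨lam, ⟨hl0, hl1⟩, C, _, hAW⟩ := hA
  obtain ⟨γ, hγ, K, hK, hmain⟩ := rh_main hpm hp1 hB hl0 hl1 hAW
  set g := Real.sqrt γ with hgdef
  have hgg : g * g = γ := Real.mul_self_sqrt (by linarith)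
  have hg : 1 < g := by
    rw [hgdef, Real.lt_sqrt (by norm_num)]; linarith
  have hg0 : 0 < g := by linarith
  refine ⟨g, hg, K, hK, g - 1, by linarith, fun Q t ht => ?_⟩
  rw [show 1 + (g - 1) = g by ring] at ht
  have hN0 := vn_cube_ne_zero hp1 Q
  have hNt := vn_cube_ne_top hp1 Q
  have hm := hmain Q
  set N := vnorm p (chiE Q.toSet) with hN
  have hNr : 0 < N.toReal := ENNReal.toReal_pos hN0 hNt
  set s0 := -Real.log N.toReal with hs0
  have hNinv : N⁻¹ = ENNReal.ofReal (Real.exp s0) := by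
    rw [hs0, Real.exp_neg, Real.exp_log hNr, ENNReal.ofReal_inv_of_pos hNr,
      ENNReal.ofReal_toReal hNt]
  have hNpow : N ^ (-g) = ENNReal.ofReal (Real.exp (g * s0)) := by
    rw [ENNReal.rpow_neg, ← ENNReal.inv_rpow, hNinv, ENNReal.ofReal_rpow_of_pos (Real.exp_pos _),
      ← Real.exp_mul, mul_comm]
  rw [hNpow, ← ENNReal.ofReal_one] at ht
  have hmin : 0 < min 1 (Real.exp (g * s0)) := lt_min one_pos (Real.exp_pos _)
  have ht1 : min 1 (Real.exp (g * s0)) ≤ t := by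
    have h1 := ht.1
    rw [← ENNReal.ofReal_min] at h1
    by_contra hc
    push Not at hc
    exact absurd h1 (not_le.2 ((ENNReal.ofReal_lt_ofReal_iff hmin).2 hc))
  have ht0 : 0 < t := hmin.trans_le ht1
  have ht2 : t ≤ max 1 (Real.exp (g * s0)) := by
    have h1 := ht.2
    rw [← ENNReal.ofReal_max] at h1
    exact (ENNReal.ofReal_le_ofReal_iff (by positivity)).1 h1
  set s := Real.log t with hs
  have hts : t = Real.exp s := (Real.exp_log ht0).symm
  have hmem : s ∈ uIcc 0 (g * s0) := by
    rw [hts] at ht1 ht2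
    rw [mem_uIcc]
    rcases le_total 0 (g * s0) with hc | hc
    · left
      have h1 : 1 ≤ Real.exp (g * s0) := Real.one_le_exp hc
      rw [min_eq_left h1, Real.one_le_exp_iff] at ht1
      rw [max_eq_right h1, Real.exp_le_exp] at ht2
      exact ⟨ht1, ht2⟩
    · right
      have h1 : Real.exp (g * s0) ≤ 1 := Real.exp_le_one_iff.2 hc
      rw [min_eq_right h1, Real.exp_le_exp] at ht1
      rw [max_eq_left h1, Real.exp_le_one_iff] at ht2
      exact ⟨ht1, ht2⟩
  have hK0 : 0 < K := by linarith
  rw [hNinv, phi_gamma] at hm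
  change phi p Q (γ * s0) ≤ ENNReal.ofReal K * phi p Q s0 ^ γ at hm
  rw [phi_le_iff hpm hp1 hB Q hK0 (by linarith), ← hgg] at hm
  have hfin := convex_aux (log_phi_convex hpm hp1 hB Q) (by simp [phi_zero]) hg
    (Real.log_nonneg hK.le) (s0 := s0) (by rw [← mul_assoc, ← mul_assoc]; exact hm) hmem
  have hfin' := (phi_le_iff hpm hp1 hB Q hK0 hg0.le).2 hfin
  rw [hts, phi_gamma]
  change phi p Q (g * s) ^ (1 / g) ≤ ENNReal.ofReal K * phi p Q s
  calc phi p Q (g * s) ^ (1 / g) ≤ (ENNReal.ofReal K * phi p Q s ^ g) ^ (1 / g) :=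
        ENNReal.rpow_le_rpow hfin' (by positivity)
    _ = ENNReal.ofReal K ^ (1 / g) * phi p Q s := by
        rw [ENNReal.mul_rpow_of_nonneg _ _ (by positivity), ← ENNReal.rpow_mul,
          mul_one_div_cancel hg0.ne', ENNReal.rpow_one]
    _ ≤ ENNReal.ofReal K * phi p Q s := by
        refine mul_le_mul_left ?_ _
        calc ENNReal.ofReal K ^ (1 / g) ≤ ENNReal.ofReal K ^ (1 : ℝ) := by
              refine ENNReal.rpow_le_rpow_of_exponent_le (ENNReal.one_le_ofReal.2 hK.le) ?_
              rw [div_le_one hg0]; exact hg.le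
          _ = _ := ENNReal.rpow_one _
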